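/- arXiv:1605.08086 — 12 statements merged into one kernel-verified Lean document; each statement's English description precedes it below -/
import Mathlib

section
/- Let N ≥ 3 and let h : (0,∞) → ℝ be convex and non-increasing. Then the set D = {x ∈ ℝ^N : x_1 < x_2 < ⋯ < x_N} is convex, and the discrete energy Ẽ_N(x) = (1/N)[ h(N Δx_2) + Σ_{i=2}^{N−1} h(N min(Δx_i, Δx_{i+1})) + h(N Δx_N) ] is a convex function on D. -/
/-- A convex non-increasing function on `(0,∞)` composed with a positive concave function
is convex. -/
theorem ConvexOn.comp_concaveOn_of_pos {E : Type*} [AddCommGroup E] [Module ℝ E]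
    {s : Set E} {h : ℝ → ℝ} {g : E → ℝ} (hconv : ConvexOn ℝ (Set.Ioi (0 : ℝ)) h)
    (hmono : AntitoneOn h (Set.Ioi (0 : ℝ))) (hg : ConcaveOn ℝ s g) (hpos : ∀ x ∈ s, 0 < g x) :
    ConvexOn ℝ s (fun x => h (g x)) := by
  refine ⟨hg.1, fun x hx y hy a b ha hb hab => ?_⟩
  exact (hmono (hconv.1 (hpos x hx) (hpos y hy) ha hb hab)
    (hpos _ (hg.1 hx hy ha hb hab)) (hg.2 hx hy ha hb hab)).trans
    (hconv.2 (hpos x hx) (hpos y hy) ha hb hab)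

/-- A finite sum of convex functions on a convex set is convex. -/
theorem ConvexOn.sum_of_forall_mem {E ι : Type*} [AddCommGroup E] [Module ℝ E] {s : Set E}
    (hs : Convex ℝ s) {t : Finset ι} {f : ι → E → ℝ} (hf : ∀ i ∈ t, ConvexOn ℝ s (f i)) :
    ConvexOn ℝ s (fun x => ∑ i ∈ t, f i x) := by
  refine ⟨hs, fun x hx y hy a b ha hb hab => ?_⟩
  simp only [Finset.smul_sum, ← Finset.sum_add_distrib]
  exact Finset.sum_le_sum fun i hi => (hf i hi).2 hx hy ha hb hab

/-- The difference of two coordinates is a concave function of the configuration. -/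
theorem concaveOn_coord_sub {ι : Type*} {s : Set (ι → ℝ)} (hs : Convex ℝ s) (i j : ι) :
    ConcaveOn ℝ s (fun x => x i - x j) :=
  (LinearMap.proj (R := ℝ) (φ := fun _ : ι => ℝ) i - LinearMap.proj j).concaveOn hs

/-- The configurations that are strictly increasing on `1, …, N` form a convex set. -/
theorem convex_setOf_increasing (N : ℕ) :
    Convex ℝ {x : ℕ → ℝ | ∀ i, 1 ≤ i → i < N → x i < x (i + 1)} := by
  intro x hx y hy a b ha hb hab i hi hiN
  have key := (convex_Ioi (0 : ℝ)) (sub_pos.2 (hx i hi hiN)) (sub_pos.2 (hy i hi hiN)) ha hb hab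
  simp only [smul_eq_mul, Set.mem_Ioi] at key
  simp only [Pi.add_apply, Pi.smul_apply, smul_eq_mul]
  linarith

/-- For `N ≥ 3` and `h : (0,∞) → ℝ` convex and non-increasing, the set of
strictly increasing configurations `x_1 < ⋯ < x_N` (indexed `1,…,N`) is convex, and the
discrete energy
`Ẽ_N(x) = (1/N)[h(N Δx_2) + ∑_{i=2}^{N-1} h(N min(Δx_i, Δx_{i+1})) + h(N Δx_N)]`
is convex on it. -/
theorem discrete_energy_convexOn (N : ℕ) (hN : 3 ≤ N) (h : ℝ → ℝ)
    (hconv : ConvexOn ℝ (Set.Ioi (0 : ℝ)) h)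
    (hmono : AntitoneOn h (Set.Ioi (0 : ℝ))) :
    Convex ℝ {x : ℕ → ℝ | ∀ i, 1 ≤ i → i < N → x i < x (i + 1)} ∧
    ConvexOn ℝ {x : ℕ → ℝ | ∀ i, 1 ≤ i → i < N → x i < x (i + 1)}
      (fun x => (1 / N : ℝ) *
        (h (N * (x 2 - x 1)) +
         ∑ i ∈ Finset.Icc 2 (N - 1),
           h (N * min (x i - x (i - 1)) (x (i + 1) - x i)) +
         h (N * (x N - x (N - 1))))) := by
  have hD := convex_setOf_increasing N
  have hN0 : (0 : ℝ) < N := by exact_mod_cast (by omega : 0 < N)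
  have energy_term {g : (ℕ → ℝ) → ℝ}
      (hg : ConcaveOn ℝ {x : ℕ → ℝ | ∀ i, 1 ≤ i → i < N → x i < x (i + 1)} g)
      (hpos : ∀ x ∈ {x : ℕ → ℝ | ∀ i, 1 ≤ i → i < N → x i < x (i + 1)}, 0 < g x) :
      ConvexOn ℝ {x : ℕ → ℝ | ∀ i, 1 ≤ i → i < N → x i < x (i + 1)}
        (fun x => h (N * g x)) :=
    hconv.comp_concaveOn_of_pos hmono (hg.smul hN0.le) fun x hx => mul_pos hN0 (hpos x hx)
  have gap_pos {x : ℕ → ℝ} (hx : ∀ i, 1 ≤ i → i < N → x i < x (i + 1)) {i : ℕ}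
      (hi : 2 ≤ i) (hiN : i ≤ N) : 0 < x i - x (i - 1) := by
    have hlt := hx (i - 1) (by omega) (by omega)
    rw [Nat.sub_add_cancel (by omega)] at hlt
    exact sub_pos.2 hlt
  have convex_first := energy_term (concaveOn_coord_sub hD 2 1)
    fun x hx => gap_pos hx le_rfl (by omega)
  have convex_last := energy_term (concaveOn_coord_sub hD N (N - 1))
    fun x hx => gap_pos hx (by omega) le_rfl
  have convex_middle := ConvexOn.sum_of_forall_mem hD (t := Finset.Icc 2 (N - 1))
    (f := fun i x => h (N * min (x i - x (i - 1)) (x (i + 1) - x i))) fun i hi => by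
      rw [Finset.mem_Icc] at hi
      exact energy_term
        ((concaveOn_coord_sub hD i (i - 1)).inf (concaveOn_coord_sub hD (i + 1) i))
        fun x hx => lt_min (gap_pos hx hi.1 (by omega))
          (sub_pos.2 (hx i (by omega) (by omega)))
  exact ⟨hD, ((convex_first.add convex_middle).add convex_last).smul (by positivity)⟩
end

section
/- Let ρ : ℝ → [0,∞) be a measurable probability density (∫_ℝ ρ = 1) with finite second moment M_2(ρ) = ∫_ℝ x² ρ(x) dx < ∞, and let δ > 0. Then the negative part of ρ log ρ is integrable and satisfies ∫_ℝ max(−ρ(x) log ρ(x), 0) dx ≤ √(2π/δ) + δ M_2(ρ); in particular, if ρ log ρ is integrable then ∫_ℝ ρ(x) log ρ(x) dx ≥ −√(2π/δ) − δ M_2(ρ). -/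
open MeasureTheory

/-- Young-type inequality for the entropy function: `-r log r ≤ exp (-a) + a r` for `r ≥ 0`. -/
theorem neg_mul_log_le_exp_neg_add_mul {r : ℝ} (hr : 0 ≤ r) (a : ℝ) :
    -(r * Real.log r) ≤ Real.exp (-a) + a * r := by
  rcases hr.eq_or_lt with rfl | hr
  · simpa using (Real.exp_pos (-a)).le
  · have h := Real.log_le_sub_one_of_pos (div_pos (Real.exp_pos (-a)) hr)
    rw [Real.log_div (Real.exp_pos _).ne' hr.ne', Real.log_exp] at h
    have hmul := mul_le_mul_of_nonneg_left h hr.le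
    rw [mul_sub, mul_sub, mul_div_cancel₀ _ hr.ne'] at hmul
    linarith

/-- Carleman-type estimate. For a probability density `ρ` on `ℝ` with finite
second moment and any `δ > 0`, the negative part of `ρ log ρ` is integrable with
`∫ (ρ log ρ)_- ≤ √(2π/δ) + δ M₂(ρ)`; in particular, if `ρ log ρ` is integrable then
`∫ ρ log ρ ≥ -√(2π/δ) - δ M₂(ρ)`. -/
theorem entropy_negative_part_bound (ρ : ℝ → ℝ) (hmeas : Measurable ρ)
    (hnonneg : ∀ x, 0 ≤ ρ x) (hint : Integrable ρ) (hmass : ∫ x, ρ x = 1)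
    (hM2 : Integrable (fun x => x ^ 2 * ρ x)) (δ : ℝ) (hδ : 0 < δ) :
    Integrable (fun x => max (-(ρ x * Real.log (ρ x))) 0) ∧
    (∫ x, max (-(ρ x * Real.log (ρ x))) 0) ≤
      Real.sqrt (2 * Real.pi / δ) + δ * ∫ x, x ^ 2 * ρ x ∧
    (Integrable (fun x => ρ x * Real.log (ρ x)) →
      -Real.sqrt (2 * Real.pi / δ) - δ * (∫ x, x ^ 2 * ρ x) ≤
        ∫ x, ρ x * Real.log (ρ x)) := by
  have hgauss : Integrable fun x : ℝ => Real.exp (-δ * x ^ 2) := integrable_exp_neg_mul_sq hδ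
  have hdom : Integrable fun x => Real.exp (-δ * x ^ 2) + δ * (x ^ 2 * ρ x) :=
    hgauss.add (hM2.const_mul δ)
  have hle : ∀ x, max (-(ρ x * Real.log (ρ x))) 0 ≤
      Real.exp (-δ * x ^ 2) + δ * (x ^ 2 * ρ x) := by
    intro x
    have hx := hnonneg x
    refine max_le ?_ (by positivity)
    have h := neg_mul_log_le_exp_neg_add_mul hx (δ * x ^ 2)
    rwa [← neg_mul δ, mul_assoc δ] at h
  have hneg : Integrable fun x => max (-(ρ x * Real.log (ρ x))) 0 := by
    refine hdom.mono' (by fun_prop) (.of_forall fun x => ?_)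
    rw [Real.norm_of_nonneg (le_max_right _ _)]
    exact hle x
  have hbound : (∫ x, max (-(ρ x * Real.log (ρ x))) 0) ≤
      Real.sqrt (2 * Real.pi / δ) + δ * ∫ x, x ^ 2 * ρ x := by
    calc (∫ x, max (-(ρ x * Real.log (ρ x))) 0)
        ≤ ∫ x, (Real.exp (-δ * x ^ 2) + δ * (x ^ 2 * ρ x)) := integral_mono hneg hdom hle
      _ = Real.sqrt (Real.pi / δ) + δ * ∫ x, x ^ 2 * ρ x := by
        rw [integral_add hgauss (hM2.const_mul δ), integral_gaussian, integral_const_mul]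
      _ ≤ Real.sqrt (2 * Real.pi / δ) + δ * ∫ x, x ^ 2 * ρ x := by
        gcongr
        linarith [Real.pi_pos]
  refine ⟨hneg, hbound, fun hent => ?_⟩
  have h := integral_mono hent.neg hneg fun x => le_max_left _ _
  simp only [Pi.neg_apply, integral_neg] at h
  linarith
end

section
/- Let ρ : ℝ → [0,∞) be a measurable probability density (∫_ℝ ρ = 1) with finite second moment M_2(ρ) = ∫_ℝ x² ρ(x) dx < ∞, such that the positive part of ρ log ρ is integrable, and let δ > 0. Then ρ log ρ is integrable and ∫_ℝ |ρ(x) log ρ(x)| dx ≤ ∫_ℝ ρ(x) log ρ(x) dx + 2δ M_2(ρ) + 2√(2π/δ). -/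
open MeasureTheory

/-- Pointwise lower bound for `r log r`, obtained from `log s ≥ 1 - s⁻¹` at `s = r exp a`. -/
theorem neg_mul_log_le_add_exp {r a : ℝ} (hr : 0 ≤ r) (ha : 0 ≤ a) :
    -(r * Real.log r) ≤ a * r + Real.exp (-(a / 2)) := by
  rcases hr.eq_or_lt with rfl | hr
  · simpa using (Real.exp_pos _).le
  have hlog := Real.one_sub_inv_le_log_of_pos (mul_pos hr (Real.exp_pos a))
  rw [Real.log_mul hr.ne' (Real.exp_pos a).ne', Real.log_exp] at hlog
  have hmul := mul_le_mul_of_nonneg_left hlog hr.le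
  have hinv : r * (r * Real.exp a)⁻¹ = Real.exp (-a) := by
    rw [Real.exp_neg, mul_inv, mul_inv_cancel_left₀ hr.ne']
  have hexp : Real.exp (-a) ≤ Real.exp (-(a / 2)) := Real.exp_le_exp.mpr (by linarith)
  linarith

/-- For a probability density `ρ` on `ℝ` with finite second moment whose
positive part of `ρ log ρ` is integrable, `ρ log ρ` is integrable and
`∫ |ρ log ρ| ≤ ∫ ρ log ρ + 2δ M₂(ρ) + 2√(2π/δ)` for every `δ > 0`. -/
theorem entropy_L1_bound (ρ : ℝ → ℝ) (hmeas : Measurable ρ)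
    (hnonneg : ∀ x, 0 ≤ ρ x) (hint : Integrable ρ) (hmass : ∫ x, ρ x = 1)
    (hM2 : Integrable (fun x => x ^ 2 * ρ x))
    (hpos : Integrable (fun x => max (ρ x * Real.log (ρ x)) 0))
    (δ : ℝ) (hδ : 0 < δ) :
    Integrable (fun x => ρ x * Real.log (ρ x)) ∧
    (∫ x, |ρ x * Real.log (ρ x)|) ≤
      (∫ x, ρ x * Real.log (ρ x)) + 2 * δ * (∫ x, x ^ 2 * ρ x) +
        2 * Real.sqrt (2 * Real.pi / δ) := by
  have hgauss : Integrable (fun x : ℝ => Real.exp (-(δ / 2) * x ^ 2)) :=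
    integrable_exp_neg_mul_sq (half_pos hδ)
  have hmoment : Integrable (fun x => δ * (x ^ 2 * ρ x)) := hM2.const_mul δ
  have hbound (x : ℝ) :
      -(ρ x * Real.log (ρ x)) ≤ δ * (x ^ 2 * ρ x) + Real.exp (-(δ / 2) * x ^ 2) := by
    have h := neg_mul_log_le_add_exp (hnonneg x) (mul_nonneg hδ.le (sq_nonneg x))
    rwa [mul_assoc, show -(δ * x ^ 2 / 2) = -(δ / 2) * x ^ 2 by ring] at h
  have hbound_nonneg (x : ℝ) : 0 ≤ δ * (x ^ 2 * ρ x) + Real.exp (-(δ / 2) * x ^ 2) :=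
    add_nonneg (mul_nonneg hδ.le (mul_nonneg (sq_nonneg x) (hnonneg x))) (Real.exp_pos _).le
  have hbound_int :
      Integrable (fun x => δ * (x ^ 2 * ρ x) + Real.exp (-(δ / 2) * x ^ 2)) :=
    hmoment.add hgauss
  have hentropy : Integrable (fun x => ρ x * Real.log (ρ x)) := by
    refine (hpos.add hbound_int).mono'
      (hmeas.mul hmeas.log).aestronglyMeasurable (ae_of_all _ fun x => ?_)
    simp only [Pi.add_apply, Real.norm_eq_abs]
    refine abs_le'.mpr ⟨?_, ?_⟩
    · linarith [le_max_left (ρ x * Real.log (ρ x)) 0, hbound_nonneg x]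
    · linarith [le_max_right (ρ x * Real.log (ρ x)) 0, hbound x]
  refine ⟨hentropy, ?_⟩
  calc (∫ x, |ρ x * Real.log (ρ x)|)
      ≤ ∫ x, (ρ x * Real.log (ρ x) +
          2 * (δ * (x ^ 2 * ρ x) + Real.exp (-(δ / 2) * x ^ 2))) := by
        refine integral_mono hentropy.abs
          (hentropy.add (hbound_int.const_mul 2)) fun x => ?_
        refine abs_le'.mpr ⟨?_, ?_⟩
        · linarith [hbound_nonneg x]
        · linarith [hbound x]
    _ = _ := by
        rw [integral_add hentropy (hbound_int.const_mul 2), integral_const_mul,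
          integral_add hmoment hgauss, integral_const_mul, integral_gaussian,
          show Real.pi / (δ / 2) = 2 * Real.pi / δ by field_simp]
        ring
end

section
/- Let N ≥ 2, let x_1 < x_2 < ⋯ < x_N be real numbers, and let δ > 0. Then the discrete heat energy satisfies E_N(x) = −log N − (1/N) Σ_{i=1}^N log r_i ≥ −√(2π/δ) − (7δ/6) · (1/N) Σ_{i=1}^N x_i². -/
/-- Integrals of a nonnegative function over consecutive nonoverlapping intervals add up to at most
its integral over an interval containing all of them. -/
theorem sum_intervalIntegral_le_of_ordered {f : ℝ → ℝ} (hf : Continuous f) (hf0 : ∀ t, 0 ≤ f t)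
    (a b : ℕ → ℝ) {n : ℕ} (hn : 1 ≤ n) (hba : ∀ i, 1 ≤ i → i < n → b i ≤ a (i + 1)) :
    ∑ i ∈ Finset.Icc 1 n, ∫ t in (a i)..(b i), f t ≤ ∫ t in (a 1)..(b n), f t := by
  induction n, hn using Nat.le_induction with
  | base => simp
  | succ k hk ih =>
    rw [Finset.sum_Icc_succ_top (by omega)]
    have hsum := ih fun i h1 h2 => hba i h1 (by omega)
    have hgap : 0 ≤ ∫ t in (b k)..(a (k + 1)), f t :=
      intervalIntegral.integral_nonneg (hba k hk (by omega)) fun t _ => hf0 t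
    have hint : ∀ u v : ℝ, IntervalIntegrable f MeasureTheory.volume u v :=
      fun u v => hf.intervalIntegrable u v
    have hsplit := intervalIntegral.integral_add_adjacent_intervals (hint (a 1) (b k))
      (hint (b k) (a (k + 1)))
    have hsplit' := intervalIntegral.integral_add_adjacent_intervals (hint (a 1) (a (k + 1)))
      (hint (a (k + 1)) (b (k + 1)))
    linarith

theorem intervalIntegral_gaussian_le {c : ℝ} (hc : 0 < c) {a b : ℝ} (hab : a ≤ b) :
    ∫ t in a..b, Real.exp (-c * t ^ 2) ≤ √(Real.pi / c) := by
  rw [intervalIntegral.integral_of_le hab, ← integral_gaussian c]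
  exact MeasureTheory.setIntegral_le_integral (integrable_exp_neg_mul_sq hc)
    (Filter.Eventually.of_forall fun t => (Real.exp_pos _).le)

/-- Entropy inequality for the uniform density `1 / (n * r)` on the interval of length `r` centred
at `x`, relative to the Gaussian weight `exp (-c * t ^ 2)`. -/
theorem uniform_entropy_ge_gaussian {n r : ℝ} (hn : 0 < n) (hr : 0 < r) (c x : ℝ) :
    -(c / n) * (x ^ 2 + r ^ 2 / 12) + 1 / n
        - ∫ t in (x - r / 2)..(x + r / 2), Real.exp (-c * t ^ 2)
      ≤ (1 / n) * (-Real.log n - Real.log r) := by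
  set a : ℝ := 1 / (n * r) with ha
  have ha0 : 0 < a := by positivity
  have hlog : Real.log a = -Real.log n - Real.log r := by
    rw [ha, one_div, Real.log_inv, Real.log_mul hn.ne' hr.ne']; ring
  have hpt : ∀ t : ℝ, a * (1 - Real.log a) + -(a * c) * t ^ 2 ≤ Real.exp (-c * t ^ 2) := by
    intro t
    have h := Real.add_one_le_exp (-c * t ^ 2 - Real.log a)
    rw [Real.exp_sub, Real.exp_log ha0, le_div_iff₀ ha0] at h
    linarith
  have hmono := intervalIntegral.integral_mono_on (μ := MeasureTheory.volume)
    (a := x - r / 2) (b := x + r / 2) (by linarith)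
    (f := fun t : ℝ => a * (1 - Real.log a) + -(a * c) * t ^ 2)
    (g := fun t : ℝ => Real.exp (-c * t ^ 2))
    (Continuous.intervalIntegrable (by fun_prop) _ _)
    (Continuous.intervalIntegrable (by fun_prop) _ _) fun t _ => hpt t
  rw [intervalIntegral.integral_add (Continuous.intervalIntegrable (by fun_prop) _ _)
    (Continuous.intervalIntegrable (by fun_prop) _ _), intervalIntegral.integral_const,
    intervalIntegral.integral_const_mul, integral_pow, smul_eq_mul, hlog] at hmono
  have har : a * r = 1 / n := by rw [ha]; field_simp
  have hlhs : (x + r / 2 - (x - r / 2)) * (a * (1 - (-Real.log n - Real.log r))) +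
      -(a * c) * (((x + r / 2) ^ (2 + 1) - (x - r / 2) ^ (2 + 1)) / ((2 : ℕ) + 1)) =
      a * r * (1 - (-Real.log n - Real.log r)) - a * r * c * (x ^ 2 + r ^ 2 / 12) := by
    push_cast; ring
  rw [hlhs, har] at hmono
  have hcn : c / n = 1 / n * c := by ring
  rw [hcn]
  linarith

/-- Lower bound on the discrete heat energy:
`E_N(x) = -log N - (1/N) ∑ log r_i ≥ -√(2π/δ) - (7δ/6)·(1/N) ∑ x_i²`. -/
theorem discrete_heat_energy_lower_bound (N : ℕ) (hN : 2 ≤ N) (x : ℕ → ℝ)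
    (hx : ∀ i, 1 ≤ i → i < N → x i < x (i + 1))
    (r : ℕ → ℝ)
    (hr1 : r 1 = x 2 - x 1)
    (hrN : r N = x N - x (N - 1))
    (hrmid : ∀ i, 2 ≤ i → i ≤ N - 1 → r i = min (x i - x (i - 1)) (x (i + 1) - x i))
    (δ : ℝ) (hδ : 0 < δ) :
    -Real.log N - (1 / N : ℝ) * ∑ i ∈ Finset.Icc 1 N, Real.log (r i)
      ≥ -Real.sqrt (2 * Real.pi / δ) -
        7 * δ / 6 * ((1 / N : ℝ) * ∑ i ∈ Finset.Icc 1 N, x i ^ 2) := by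
  have hn : (0 : ℝ) < N := by exact_mod_cast (by omega : 0 < N)
  have hx' : ∀ i, 2 ≤ i → i ≤ N → x (i - 1) < x i := by
    intro i h2 hi
    have h := hx (i - 1) (by omega) (by omega)
    rwa [Nat.sub_add_cancel (by omega)] at h
  have hle_right : ∀ i, 1 ≤ i → i < N → r i ≤ x (i + 1) - x i := by
    intro i h1 hi
    rcases eq_or_lt_of_le h1 with rfl | h2
    · exact hr1.le
    · rw [hrmid i h2 (by omega)]; exact min_le_right _ _
  have hle_left : ∀ i, 2 ≤ i → i ≤ N → r i ≤ x i - x (i - 1) := by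
    intro i h2 hi
    rcases eq_or_lt_of_le hi with rfl | hlt
    · exact hrN.le
    · rw [hrmid i h2 (by omega)]; exact min_le_left _ _
  have hpos : ∀ i, 1 ≤ i → i ≤ N → 0 < r i := by
    intro i h1 hi
    rcases eq_or_lt_of_le h1 with rfl | h2
    · rw [hr1]; exact sub_pos.2 (hx 1 le_rfl (by omega))
    rcases eq_or_lt_of_le hi with rfl | hlt
    · rw [hrN]; exact sub_pos.2 (hx' i h2 le_rfl)
    · rw [hrmid i h2 (by omega)]
      exact lt_min (sub_pos.2 (hx' i h2 hi)) (sub_pos.2 (hx i h1 hlt))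
  set S : ℝ := ∑ i ∈ Finset.Icc 1 N, x i ^ 2 with hS
  have hrsq : ∑ i ∈ Finset.Icc 1 N, r i ^ 2 ≤ 6 * S := by
    have hpartial : ∀ k, 1 ≤ k → k ≤ N → ∑ i ∈ Finset.Icc 1 k, r i ^ 2 ≤
        2 * S + 4 * ∑ i ∈ Finset.Icc 1 k, x i ^ 2 - 2 * x k ^ 2 := by
      intro k hk
      induction k, hk using Nat.le_induction with
      | base =>
        intro _
        have h12 : x 1 ^ 2 + x 2 ^ 2 ≤ S := by
          have h := Finset.sum_le_sum_of_subset_of_nonneg (s := Finset.Icc 1 2)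
            (t := Finset.Icc 1 N) (f := fun i => x i ^ 2) (Finset.Icc_subset_Icc_right hN)
            fun i _ _ => sq_nonneg _
          rwa [Finset.sum_Icc_succ_top (by omega), Finset.Icc_self, Finset.sum_singleton] at h
        simp only [Finset.Icc_self, Finset.sum_singleton, hr1]
        nlinarith [sq_nonneg (x 1 + x 2), sq_nonneg (x 1)]
      | succ k hk ih =>
        intro hkN
        have hih := ih (by omega)
        rw [Finset.sum_Icc_succ_top (by omega), Finset.sum_Icc_succ_top (by omega)]
        have hl : r (k + 1) ≤ x (k + 1) - x k := hle_left (k + 1) (by omega) hkN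
        have hsq := pow_le_pow_left₀ (hpos (k + 1) (by omega) hkN).le hl 2
        nlinarith [sq_nonneg (x (k + 1) + x k)]
    have h := hpartial N (by omega) le_rfl
    linarith [sq_nonneg (x N)]
  have hgauss : ∑ i ∈ Finset.Icc 1 N,
      ∫ t in (x i - r i / 2)..(x i + r i / 2), Real.exp (-(δ / 2) * t ^ 2)
        ≤ √(2 * Real.pi / δ) := by
    have hordered : x 1 ≤ x N := by
      have hmono : ∀ k, 1 ≤ k → k ≤ N → x 1 ≤ x k := by
        intro k hk
        induction k, hk using Nat.le_induction with
        | base => exact fun _ => le_rfl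
        | succ k hk ih => exact fun h => (ih (by omega)).trans (hx k hk (by omega)).le
      exact hmono N (by omega) le_rfl
    have hr1pos := hpos 1 le_rfl (by omega)
    have hrNpos := hpos N (by omega) le_rfl
    have hwhole := intervalIntegral_gaussian_le (half_pos hδ)
      (a := x 1 - r 1 / 2) (b := x N + r N / 2) (by linarith)
    rw [show Real.pi / (δ / 2) = 2 * Real.pi / δ by field_simp] at hwhole
    refine le_trans ?_ hwhole
    refine sum_intervalIntegral_le_of_ordered (f := fun t => Real.exp (-(δ / 2) * t ^ 2))
      (by fun_prop) (fun t => (Real.exp_pos _).le)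
      (fun i => x i - r i / 2) (fun i => x i + r i / 2) (by omega) fun i h1 hi => ?_
    have hright := hle_right i h1 hi
    have hleft : r (i + 1) ≤ x (i + 1) - x i := hle_left (i + 1) (by omega) hi
    linarith
  have hentropy := Finset.sum_le_sum fun i (hi : i ∈ Finset.Icc 1 N) =>
    uniform_entropy_ge_gaussian hn
      (hpos i (Finset.mem_Icc.1 hi).1 (Finset.mem_Icc.1 hi).2) (δ / 2) (x i)
  simp only [Finset.sum_sub_distrib, Finset.sum_add_distrib, ← Finset.mul_sum,
    ← Finset.sum_div, Finset.sum_const, Nat.card_Icc, Nat.add_sub_cancel, nsmul_eq_mul] at hentropy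
  rw [← hS, mul_sub, show (1 / N : ℝ) * (N * -Real.log N) = -Real.log N by field_simp,
    mul_one, div_self hn.ne'] at hentropy
  have hsecond : δ / 2 / N * (S + (∑ i ∈ Finset.Icc 1 N, r i ^ 2) / 12)
      ≤ 7 * δ / 6 * (1 / N * S) := by
    have hS0 : 0 ≤ S := Finset.sum_nonneg fun i _ => sq_nonneg _
    calc δ / 2 / N * (S + (∑ i ∈ Finset.Icc 1 N, r i ^ 2) / 12)
        ≤ δ / 2 / N * (7 / 3 * S) := by gcongr; linarith
      _ = 7 * δ / 6 * (1 / N * S) := by ring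
  linarith
end

section
/- Let T > 0, N ≥ 2, and let x : [0,T] → ℝ^N be an absolutely continuous curve such that x_1(t) < ⋯ < x_N(t) for every t and x'(t) ∈ −∂_w E_N(x(t)) for almost every t ∈ [0,T], where E_N(x) = −log N − (1/N) Σ_{i=1}^N log r_i is the discrete heat energy. Assume E_N(x(0)) ≤ e_0 and (1/N) Σ_{i=1}^N x_i(0)² ≤ m_0. Then for all t ∈ [0,T]: (1/N) Σ_{i=1}^N x_i(t)² ≤ M_0(T) := 8(e_0 + √(56πT/3)) T + 4 m_0, and for every δ > 0, E_N(x(t)) ≥ −√(2π/δ) − (7δ/6) M_0(T). -/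
open MeasureTheory Set

/-- Ball radius `r_i = min(Δx_i, Δx_{i+1})` with the whole-line conventions
`r_1 = Δx_2` and `r_N = Δx_N` (particles indexed `1,…,N`). -/
noncomputable def rGap (N : ℕ) (x : ℕ → ℝ) (i : ℕ) : ℝ :=
  if i = 1 then x 2 - x 1
  else if i = N then x N - x (N - 1)
  else min (x i - x (i - 1)) (x (i + 1) - x i)

/-- The discrete heat energy `E_N(x) = -log N - (1/N) ∑_{i=1}^N log r_i`. -/
noncomputable def heatEnergy (N : ℕ) (x : ℕ → ℝ) : ℝ :=
  -Real.log N - (1 / N : ℝ) * ∑ i ∈ Finset.Icc 1 N, Real.log (rGap N x i)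

/-- A strictly increasing configuration of `N` particles (indexed `1,…,N`). -/
def IncCfg (N : ℕ) (x : ℕ → ℝ) : Prop := ∀ i, 1 ≤ i → i < N → x i < x (i + 1)

/-- The bounded increasing profile `a ↦ a / (s + |a|)` spreads the points `a < b` by at least
`s (b - a) / ((s + |a|) (s + |b|))`. -/
theorem mul_sub_le_div_add_abs_sub {s a b : ℝ} (hs : 0 < s) (hab : a < b) :
    s * (b - a) / ((s + |a|) * (s + |b|)) ≤ b / (s + |b|) - a / (s + |a|) := by
  have ha : 0 < s + |a| := by positivity
  have hb : 0 < s + |b| := by positivity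
  rw [div_sub_div _ _ hb.ne' ha.ne', mul_comm (s + |b|) (s + |a|)]
  apply div_le_div_of_nonneg_right _ (by positivity)
  rcases abs_cases a with ⟨h1, h2⟩ | ⟨h1, h2⟩ <;> rcases abs_cases b with ⟨h3, h4⟩ | ⟨h3, h4⟩ <;>
    rw [h1, h3] <;> nlinarith

theorem abs_div_add_abs_le_one {s : ℝ} (hs : 0 < s) (a : ℝ) : |a / (s + |a|)| ≤ 1 := by
  have ha : 0 < s + |a| := by positivity
  rw [abs_div, abs_of_pos ha, div_le_one ha]
  linarith

theorem log_le_div_sub_one_add_log {a c : ℝ} (ha : 0 < a) (hc : 0 < c) :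
    Real.log a ≤ a / c - 1 + Real.log c := by
  have := Real.log_le_sub_one_of_pos (div_pos ha hc)
  rw [Real.log_div ha.ne' hc.ne'] at this
  linarith

theorem log_one_add_abs_div_le {s : ℝ} (hs : 0 < s) (a : ℝ) :
    Real.log (1 + |a| / s) ≤ Real.log 2 + (a ^ 2 / s ^ 2 - 1) / 4 := by
  have h1 := log_le_div_sub_one_add_log (a := 1 + |a| / s) (c := 2) (by positivity) two_pos
  have h2 : a ^ 2 / s ^ 2 = (|a| / s) ^ 2 := by rw [div_pow, sq_abs]
  rw [h2]
  nlinarith [sq_nonneg (|a| / s - 1)]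

/-- Logarithmic bound of a length dominated by a product `s d (1 + |a|/s) (1 + |b|/s)`. -/
theorem log_le_of_le_mul {s d a b r c : ℝ} (hs : 0 < s) (hd : 0 < d) (hc : 0 < c) (hr : 0 < r)
    (h : r ≤ s * d * ((1 + |a| / s) * (1 + |b| / s))) :
    Real.log r ≤ (Real.log s - 1 + Real.log c) + d / c
      + (Real.log 2 + (a ^ 2 / s ^ 2 - 1) / 4) + (Real.log 2 + (b ^ 2 / s ^ 2 - 1) / 4) := by
  have ha : 0 < 1 + |a| / s := by positivity
  have hb : 0 < 1 + |b| / s := by positivity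
  have h1 := Real.log_le_log hr h
  rw [Real.log_mul (by positivity) (by positivity), Real.log_mul hs.ne' hd.ne',
    Real.log_mul ha.ne' hb.ne'] at h1
  have := log_le_div_sub_one_add_log hd hc
  have := log_one_add_abs_div_le hs a
  have := log_one_add_abs_div_le hs b
  linarith

theorem sum_Icc_one_succ_eq_first (n : ℕ) (g : ℕ → ℝ) :
    ∑ i ∈ Finset.Icc 1 (n + 1), g i = ∑ k ∈ Finset.range n, g (k + 2) + g 1 := by
  rw [← Finset.sum_range_succ' (fun k => g (k + 1)), Finset.range_eq_Ico,
    Finset.sum_Ico_add' g 0 (n + 1) 1]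
  rfl

theorem sum_Icc_one_succ_eq_last (n : ℕ) (g : ℕ → ℝ) :
    ∑ i ∈ Finset.Icc 1 (n + 1), g i = ∑ k ∈ Finset.range n, g (k + 1) + g (n + 1) := by
  rw [← Finset.sum_range_succ (fun k => g (k + 1)), Finset.range_eq_Ico,
    Finset.sum_Ico_add' g 0 (n + 1) 1]
  rfl

theorem IncCfg.le_last {N : ℕ} {x : ℕ → ℝ} (hx : IncCfg N x) {i : ℕ} (hi : 1 ≤ i) (hiN : i ≤ N) :
    x i ≤ x N := by
  have key : ∀ j, i ≤ j → j ≤ N → x i ≤ x j := by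
    intro j hj
    induction j, hj using Nat.le_induction with
    | base => exact fun _ => le_rfl
    | succ j hj ih => exact fun h => (ih (by omega)).trans (hx j (by omega) (by omega)).le
  exact key N hiN le_rfl

theorem rGap_pos {N : ℕ} (hN : 2 ≤ N) {x : ℕ → ℝ} (hx : IncCfg N x) {i : ℕ}
    (hi : i ∈ Finset.Icc 1 N) : 0 < rGap N x i := by
  obtain ⟨h1, h2⟩ := Finset.mem_Icc.1 hi
  have hprev : ∀ j, 2 ≤ j → j ≤ N → x (j - 1) < x j := fun j h h' => by
    have := hx (j - 1) (by omega) (by omega)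
    rwa [Nat.sub_add_cancel (by omega)] at this
  unfold rGap
  split_ifs with h h'
  · exact sub_pos.2 (hprev 2 le_rfl hN)
  · exact sub_pos.2 (hprev N hN le_rfl)
  · exact lt_min (sub_pos.2 (hprev i (by omega) h2)) (sub_pos.2 (hx i h1 (by omega)))

theorem rGap_add_two_le (N : ℕ) (x : ℕ → ℝ) (k : ℕ) :
    rGap N x (k + 2) ≤ x (k + 2) - x (k + 1) := by
  unfold rGap
  split_ifs with h h'
  · omega
  · subst h'
    rfl
  · exact min_le_left _ _

/-- The heat energy is bounded below by the logarithm of the second moment. -/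
theorem neg_log_le_heatEnergy {N : ℕ} (hN : 2 ≤ N) {x : ℕ → ℝ} (hx : IncCfg N x) {m : ℝ}
    (hm : 0 < m) (hxm : (1 / N : ℝ) * ∑ i ∈ Finset.Icc 1 N, (x i) ^ 2 ≤ m) :
    -(Real.log 12 + Real.log m / 2) ≤ heatEnergy N x := by
  obtain ⟨n, rfl⟩ : ∃ n, N = n + 1 := ⟨N - 1, by omega⟩
  have hNpos : (0 : ℝ) < ((n + 1 : ℕ) : ℝ) := by positivity
  set M : ℝ := ((n + 1 : ℕ) : ℝ) with hM
  set s := Real.sqrt m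
  have hs : 0 < s := Real.sqrt_pos.2 hm
  have hs2 : s ^ 2 = m := Real.sq_sqrt hm.le
  have hlogs : Real.log s = Real.log m / 2 := Real.log_sqrt hm.le
  let F : ℝ → ℝ := fun a => a / (s + |a|)
  let L : ℕ → ℝ := fun i => Real.log 2 + ((x i) ^ 2 / s ^ 2 - 1) / 4
  let A : ℝ := Real.log s - 1 + Real.log (3 / M)
  have hc : 0 < 3 / M := by positivity
  have hfirst : Real.log (rGap (n + 1) x 1) ≤ A + 1 / (3 / M) + L 1 + L (n + 1) := by
    apply log_le_of_le_mul hs one_pos hc (rGap_pos hN hx (by simp))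
    have h1 : rGap (n + 1) x 1 = x 2 - x 1 := by simp [rGap]
    have h2 := hx.le_last (i := 2) (by omega) hN
    have h3 : s * 1 * ((1 + |x 1| / s) * (1 + |x (n + 1)| / s))
        = s + |x 1| + |x (n + 1)| + |x 1| * |x (n + 1)| / s := by
      field_simp
      ring
    have h4 : 0 ≤ |x 1| * |x (n + 1)| / s := by positivity
    have := neg_abs_le (x 1)
    have := le_abs_self (x (n + 1))
    rw [h1, h3]
    linarith
  have hrest : ∀ k ∈ Finset.range n, Real.log (rGap (n + 1) x (k + 2)) ≤
      A + (F (x (k + 2)) - F (x (k + 1))) / (3 / M) + L (k + 2) + L (k + 1) := by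
    intro k hk
    have hk' := Finset.mem_range.1 hk
    have hlt : x (k + 1) < x (k + 2) := hx (k + 1) (by omega) (by omega)
    have hF := mul_sub_le_div_add_abs_sub hs hlt
    have ha : 0 < s + |x (k + 1)| := by positivity
    have hb : 0 < s + |x (k + 2)| := by positivity
    have hgap : 0 < x (k + 2) - x (k + 1) := sub_pos.2 hlt
    refine log_le_of_le_mul hs ((by positivity : (0 : ℝ) < _).trans_le hF) hc
      (rGap_pos hN hx (Finset.mem_Icc.2 (by omega))) ?_
    refine (rGap_add_two_le _ x k).trans ?_
    have hw : ∀ a, s * (1 + |a| / s) = s + |a| := fun a => by field_simp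
    rw [div_le_iff₀ (by positivity)] at hF
    refine le_of_mul_le_mul_left ?_ hs
    calc s * (x (k + 2) - x (k + 1)) ≤ _ := hF
      _ = (F (x (k + 2)) - F (x (k + 1))) *
          ((s * (1 + |x (k + 1)| / s)) * (s * (1 + |x (k + 2)| / s))) := by rw [hw, hw]
      _ = _ := by ring
  have hsum : ∑ i ∈ Finset.Icc 1 (n + 1), Real.log (rGap (n + 1) x i) ≤
      M * A + (1 + F (x (n + 1)) - F (x 1)) / (3 / M) + 2 * ∑ i ∈ Finset.Icc 1 (n + 1), L i := by
    have htel := Finset.sum_range_sub (fun k => F (x (k + 1))) n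
    have h1 := Finset.sum_le_sum hrest
    simp only [Finset.sum_add_distrib, ← Finset.sum_div, Finset.sum_const, Finset.card_range,
      nsmul_eq_mul, zero_add, add_assoc, one_add_one_eq_two] at h1 htel
    rw [htel] at h1
    have h2 := sum_Icc_one_succ_eq_first n L
    have h3 := sum_Icc_one_succ_eq_last n L
    rw [sum_Icc_one_succ_eq_first]
    have h4 : M = n + 1 := by rw [hM]; push_cast; ring
    have h5 : (1 + F (x (n + 1)) - F (x 1)) / (3 / M)
      = 1 / (3 / M) + (F (x (n + 1)) - F (x 1)) / (3 / M) := by ring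
    have h6 : M * A = n * A + A := by rw [h4]; ring
    rw [h5, h6]
    linarith
  have hL : ∑ i ∈ Finset.Icc 1 (n + 1), L i ≤ M * Real.log 2 := by
    have h1 : ∑ i ∈ Finset.Icc 1 (n + 1), L i
        = M * Real.log 2 + ((∑ i ∈ Finset.Icc 1 (n + 1), (x i) ^ 2) / s ^ 2 - M) / 4 := by
      simp only [L, Finset.sum_add_distrib, ← Finset.sum_div, Finset.sum_sub_distrib,
        Finset.sum_const, Nat.card_Icc, nsmul_eq_mul, Nat.add_sub_cancel]
      rw [← hM, mul_one]
    have h2 : (∑ i ∈ Finset.Icc 1 (n + 1), (x i) ^ 2) / s ^ 2 ≤ M := by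
      rw [hs2, div_le_iff₀ hm]
      rwa [one_div, inv_mul_le_iff₀ hNpos] at hxm
    linarith
  have hFd : (1 + F (x (n + 1)) - F (x 1)) / (3 / M) ≤ M := by
    rw [div_le_iff₀ hc, mul_div_cancel₀ _ hNpos.ne']
    have h1 := (abs_le.1 (abs_div_add_abs_le_one hs (x (n + 1)))).2
    have h2 := (abs_le.1 (abs_div_add_abs_le_one hs (x 1))).1
    simp only [F]
    linarith
  have h12 : Real.log 12 = Real.log 3 + 2 * Real.log 2 := by
    rw [show (12 : ℝ) = 3 * 2 ^ 2 by norm_num, Real.log_mul (by norm_num) (by norm_num),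
      Real.log_pow]
    norm_num
  have htot : ∑ i ∈ Finset.Icc 1 (n + 1), Real.log (rGap (n + 1) x i) ≤
      M * (Real.log 12 + Real.log m / 2 - Real.log M) := by
    have hA : M * A + M + 2 * (M * Real.log 2)
        = M * (Real.log 12 + Real.log m / 2 - Real.log M) := by
      simp only [A]
      rw [Real.log_div (by norm_num) hNpos.ne', hlogs, h12]
      ring
    linarith
  have := (inv_mul_le_iff₀ hNpos).2 htot
  unfold heatEnergy
  rw [← hM, one_div]
  linarith

theorem IncCfg.sum_sq_pos {N : ℕ} (hN : 2 ≤ N) {x : ℕ → ℝ} (hx : IncCfg N x) :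
    0 < ∑ i ∈ Finset.Icc 1 N, (x i) ^ 2 := by
  have h12 : x 1 < x 2 := hx 1 le_rfl (by omega)
  refine Finset.sum_pos' (fun i _ => sq_nonneg _) ?_
  by_cases h : x 1 = 0
  · have : x 2 ≠ 0 := by linarith
    exact ⟨2, Finset.mem_Icc.2 (by omega), by positivity⟩
  · exact ⟨1, Finset.mem_Icc.2 (by omega), by positivity⟩

theorem rGap_smul (N : ℕ) (x : ℕ → ℝ) {c : ℝ} (hc : 0 ≤ c) (i : ℕ) :
    rGap N (fun j => c * x j) i = c * rGap N x i := by
  unfold rGap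
  split_ifs
  · ring
  · ring
  · rw [mul_min_of_nonneg _ _ hc]
    ring_nf

theorem heatEnergy_smul {N : ℕ} (hN : 2 ≤ N) {x : ℕ → ℝ} (hx : IncCfg N x) {c : ℝ} (hc : 0 < c) :
    heatEnergy N (fun j => c * x j) = heatEnergy N x - Real.log c := by
  have hN0 : (N : ℝ) ≠ 0 := by
    have : N ≠ 0 := by omega
    exact_mod_cast this
  have h : ∑ i ∈ Finset.Icc 1 N, Real.log (rGap N (fun j => c * x j) i)
      = N * Real.log c + ∑ i ∈ Finset.Icc 1 N, Real.log (rGap N x i) := by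
    rw [Finset.sum_congr rfl fun i hi => by
      rw [rGap_smul N x hc.le, Real.log_mul hc.ne' (rGap_pos hN hx hi).ne']]
    simp [Finset.sum_add_distrib]
  unfold heatEnergy
  rw [h]
  field_simp
  ring

/-- Testing the subgradient inequality along dilations bounds `(1/N) ∑ x_i v_i` by `1`. -/
theorem sum_mul_le_of_subgradient {N : ℕ} (hN : 2 ≤ N) {x v : ℕ → ℝ} (hx : IncCfg N x)
    (h : ∀ y : ℕ → ℝ, IncCfg N y →
      heatEnergy N y ≥ heatEnergy N x + ∑ i ∈ Finset.Icc 1 N, (-(v i) / N) * (y i - x i)) :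
    ∑ i ∈ Finset.Icc 1 N, x i * v i ≤ N := by
  have hNpos : (0 : ℝ) < N := by
    have : 0 < N := by omega
    exact_mod_cast this
  set S := (∑ i ∈ Finset.Icc 1 N, x i * v i) / N with hS
  suffices S ≤ 1 by rwa [hS, div_le_one hNpos] at this
  have key : ∀ a : ℝ, 1 < a → S ≤ a := by
    intro a ha
    have ha0 : 0 < a := by linarith
    have hainv : a⁻¹ < 1 := inv_lt_one_of_one_lt₀ ha
    have h1 := h (fun j => a⁻¹ * x j) fun i hi hiN =>
      mul_lt_mul_of_pos_left (hx i hi hiN) (inv_pos.2 ha0)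
    have h2 : ∑ i ∈ Finset.Icc 1 N, (-(v i) / N) * (a⁻¹ * x i - x i) = (1 - a⁻¹) * S := by
      rw [hS, Finset.sum_div, Finset.mul_sum]
      exact Finset.sum_congr rfl fun i _ => by ring
    rw [heatEnergy_smul hN hx (inv_pos.2 ha0), h2, Real.log_inv] at h1
    have h3 := Real.log_le_sub_one_of_pos ha0
    have h4 : (1 - a⁻¹) * S ≤ (1 - a⁻¹) * a := by
      rw [sub_mul 1 a⁻¹ a, inv_mul_cancel₀ ha0.ne']
      linarith
    exact le_of_mul_le_mul_left h4 (by linarith)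
  exact le_of_forall_gt_imp_ge_of_dense key

/-- Chain rule for the square of a primitive of an integrable function. -/
theorem sq_add_integral_sub_sq {u : ℝ → ℝ} {t : ℝ} (hu : IntervalIntegrable u volume 0 t) (c : ℝ) :
    IntervalIntegrable (fun s => (c + ∫ τ in (0 : ℝ)..s, u τ) * u s) volume 0 t ∧
    (c + ∫ τ in (0 : ℝ)..t, u τ) ^ 2 - c ^ 2
      = 2 * ∫ s in (0 : ℝ)..t, (c + ∫ τ in (0 : ℝ)..s, u τ) * u s := by
  have hac : AbsolutelyContinuousOnInterval (fun s => c + ∫ τ in (0 : ℝ)..s, u τ) 0 t :=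
    (LipschitzWith.const c).lipschitzOnWith.absolutelyContinuousOnInterval.fun_add
      (hu.absolutelyContinuousOnInterval_intervalIntegral left_mem_uIcc)
  refine ⟨hu.continuousOn_mul hac.continuousOn, ?_⟩
  have h := hac.integral_deriv_mul_eq_sub hac
  rw [← intervalIntegral.integral_const_mul]
  have h2 : (c + ∫ τ in (0 : ℝ)..t, u τ) ^ 2 - c ^ 2 = (c + ∫ τ in (0 : ℝ)..t, u τ) *
      (c + ∫ τ in (0 : ℝ)..t, u τ) - (c + ∫ τ in (0 : ℝ)..0, u τ) *
      (c + ∫ τ in (0 : ℝ)..0, u τ) := by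
    rw [intervalIntegral.integral_same]
    ring
  rw [h2, ← h]
  apply intervalIntegral.integral_congr_ae
  filter_upwards [hu.ae_hasDerivAt_integral] with s hs hst
  have hd := ((hs (uIoc_subset_uIcc hst) 0 left_mem_uIcc).const_add c).deriv
  rw [hd]
  ring

/-- The second moment of a discrete heat flow grows at most linearly with slope `2`. -/
theorem sum_sq_le_of_flow {T : ℝ} {N : ℕ} (hN : 2 ≤ N) {x v : ℝ → ℕ → ℝ}
    (hinc : ∀ t ∈ Icc (0 : ℝ) T, IncCfg N (x t))
    (hvint : ∀ i, IntervalIntegrable (fun s => v s i) volume 0 T)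
    (hftc : ∀ t ∈ Icc (0 : ℝ) T, ∀ i, x t i = x 0 i + ∫ s in (0 : ℝ)..t, v s i)
    (hincl : ∀ᵐ t ∂(volume.restrict (Icc (0 : ℝ) T)),
      ∀ y : ℕ → ℝ, IncCfg N y →
        heatEnergy N y ≥ heatEnergy N (x t) +
          ∑ i ∈ Finset.Icc 1 N, (-(v t i) / N) * (y i - x t i))
    {t : ℝ} (ht : t ∈ Icc (0 : ℝ) T) :
    ∑ i ∈ Finset.Icc 1 N, (x t i) ^ 2 ≤ ∑ i ∈ Finset.Icc 1 N, (x 0 i) ^ 2 + 2 * t * N := by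
  have hsub : uIcc 0 t ⊆ uIcc 0 T := by
    rw [uIcc_of_le ht.1, uIcc_of_le (ht.1.trans ht.2)]
    exact Icc_subset_Icc_right ht.2
  have hchain := fun i => sq_add_integral_sub_sq ((hvint i).mono_set hsub) (x 0 i)
  have hsum_int := IntervalIntegrable.sum (Finset.Icc 1 N) fun i _ => (hchain i).1
  rw [Finset.sum_fn] at hsum_int
  have hle : ∫ s in (0 : ℝ)..t, ∑ i ∈ Finset.Icc 1 N,
      (x 0 i + ∫ τ in (0 : ℝ)..s, v τ i) * v s i ≤ ∫ _ in (0 : ℝ)..t, (N : ℝ) := by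
    refine intervalIntegral.integral_mono_ae_restrict ht.1
      hsum_int intervalIntegrable_const ?_
    have hae := ae_restrict_of_ae_restrict_of_subset (Icc_subset_Icc_right ht.2) hincl
    filter_upwards [hae, ae_restrict_mem measurableSet_Icc] with s hs hst
    have hsT : s ∈ Icc 0 T := ⟨hst.1, hst.2.trans ht.2⟩
    simp only [← hftc s hsT]
    exact sum_mul_le_of_subgradient hN (hinc s hsT) hs
  rw [intervalIntegral.integral_finsetSum fun i _ => (hchain i).1,
    intervalIntegral.integral_const, sub_zero, smul_eq_mul] at hle
  have heq : ∑ i ∈ Finset.Icc 1 N, (x t i) ^ 2 - ∑ i ∈ Finset.Icc 1 N, (x 0 i) ^ 2 =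
      2 * ∑ i ∈ Finset.Icc 1 N, ∫ s in (0 : ℝ)..t,
        (x 0 i + ∫ τ in (0 : ℝ)..s, v τ i) * v s i := by
    rw [← Finset.sum_sub_distrib, Finset.mul_sum]
    exact Finset.sum_congr rfl fun i _ => by rw [hftc t ht i, (hchain i).2]
  linarith

theorem log_le_log_add_natCast {a b : ℝ} (ha : 0 < a) (hb : 0 < b) (k : ℕ) (h : a ≤ b * 2.7 ^ k) :
    Real.log a ≤ Real.log b + k := by
  have he : (2.7 : ℝ) ^ k ≤ Real.exp k := by
    rw [← Real.exp_one_pow]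
    gcongr
    linarith [Real.exp_one_gt_d9]
  rw [← Real.log_exp (k : ℝ), ← Real.log_mul hb.ne' (Real.exp_pos _).ne']
  exact Real.log_le_log ha (h.trans (by gcongr))

theorem two_mul_log_twelve : 2 * Real.log 12 = Real.log 144 := by
  rw [show (144 : ℝ) = 12 ^ 2 by norm_num, Real.log_pow]
  norm_num

theorem log_twelve_add_half_log_le {m δ : ℝ} (hm : 0 < m) (hδ : 0 < δ) :
    Real.log 12 + Real.log m / 2 ≤ Real.sqrt (2 * Real.pi / δ) + 7 * δ / 6 * m := by
  have hpi := Real.pi_pos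
  have hq : 0 < 2 * Real.pi / δ := by positivity
  have hw := Real.log_le_sub_one_of_pos (Real.sqrt_pos.2 hq)
  rw [Real.log_sqrt hq.le] at hw
  have hp0 : 0 < 2 * (7 * δ / 6 * m) := by positivity
  have hp := Real.log_le_sub_one_of_pos hp0
  have hsplit : Real.log (2 * Real.pi / δ) + Real.log (2 * (7 * δ / 6 * m))
      = Real.log (14 * Real.pi / 3) + Real.log m := by
    rw [← Real.log_mul hq.ne' hp0.ne', ← Real.log_mul (by positivity) hm.ne']
    congr 1
    field_simp
    ring
  have hconst := log_le_log_add_natCast (a := 144) (b := 14 * Real.pi / 3) (by norm_num)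
    (by positivity) 3 (by norm_num; linarith [Real.pi_gt_d2])
  push_cast at hconst
  linarith [two_mul_log_twelve]

theorem moment_le_of_log_bound {T m : ℝ} (hT : 0 < T) (hm : 0 < m) :
    m + 2 * T ≤ 8 * (-(Real.log 12 + Real.log m / 2) + Real.sqrt (56 * Real.pi * T / 3)) * T
      + 4 * m := by
  have hpi := Real.pi_pos
  have hq : 0 < 56 * Real.pi * T / 3 := by positivity
  have hw := Real.log_le_sub_one_of_pos (Real.sqrt_pos.2 hq)
  rw [Real.log_sqrt hq.le] at hw
  have hT' : 0 < 4 * T / 3 := by positivity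
  have hlm := log_le_div_sub_one_add_log hm hT'
  have hsplit : Real.log (56 * Real.pi * T / 3)
      = Real.log (14 * Real.pi) + Real.log (4 * T / 3) := by
    rw [← Real.log_mul (by positivity) hT'.ne']
    congr 1
    ring
  have hconst := log_le_log_add_natCast (a := 144) (b := 14 * Real.pi) (by norm_num)
    (by positivity) 2 (by norm_num; linarith [Real.pi_gt_d2])
  push_cast at hconst
  have hmain : 1 / 4 - 3 * m / (8 * T) ≤
      -(Real.log 12 + Real.log m / 2) + Real.sqrt (56 * Real.pi * T / 3) := by
    have : m / (4 * T / 3) = 2 * (3 * m / (8 * T)) := by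
      field_simp
      ring
    linarith [two_mul_log_twelve]
  have hmul := mul_le_mul_of_nonneg_right hmain (show 0 ≤ 8 * T by positivity)
  have hexp : (1 / 4 - 3 * m / (8 * T)) * (8 * T) = 2 * T - 3 * m := by
    field_simp
    ring
  linarith

/-- A discrete gradient flow for the heat energy
(`x` absolutely continuous with a.e. derivative `v`, `x' ∈ -∂_w E_N(x)` a.e.,
i.e. `-(x'(t))/N` is a subgradient of the heat energy---extended by `+∞` outside
increasing configurations---at `x(t)`), with `E_N(x(0)) ≤ e₀` and second moment
`≤ m₀` initially, satisfies for all `t ∈ [0,T]` the moment bound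
`(1/N) ∑ x_i(t)² ≤ M₀(T) := 8(e₀ + √(56πT/3))T + 4m₀` and for every `δ > 0` the
energy bound `E_N(x(t)) ≥ -√(2π/δ) - (7δ/6) M₀(T)`. -/
theorem discrete_heat_flow_bounds (T : ℝ) (hT : 0 < T) (N : ℕ) (hN : 2 ≤ N)
    (x v : ℝ → ℕ → ℝ) (e0 m0 : ℝ)
    (hinc : ∀ t ∈ Icc (0 : ℝ) T, IncCfg N (x t))
    (hvint : ∀ i, IntervalIntegrable (fun s => v s i) volume 0 T)
    (hftc : ∀ t ∈ Icc (0 : ℝ) T, ∀ i, x t i = x 0 i + ∫ s in (0 : ℝ)..t, v s i)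
    (hincl : ∀ᵐ t ∂(volume.restrict (Icc (0 : ℝ) T)),
      ∀ y : ℕ → ℝ, IncCfg N y →
        heatEnergy N y ≥ heatEnergy N (x t) +
          ∑ i ∈ Finset.Icc 1 N, (-(v t i) / N) * (y i - x t i))
    (he0 : heatEnergy N (x 0) ≤ e0)
    (hm0 : (1 / N : ℝ) * ∑ i ∈ Finset.Icc 1 N, (x 0 i) ^ 2 ≤ m0) :
    ∀ t ∈ Icc (0 : ℝ) T,
      (1 / N : ℝ) * ∑ i ∈ Finset.Icc 1 N, (x t i) ^ 2 ≤
        8 * (e0 + Real.sqrt (56 * Real.pi * T / 3)) * T + 4 * m0 ∧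
      ∀ δ : ℝ, 0 < δ →
        heatEnergy N (x t) ≥ -Real.sqrt (2 * Real.pi / δ) -
          7 * δ / 6 * (8 * (e0 + Real.sqrt (56 * Real.pi * T / 3)) * T + 4 * m0) := by
  have hN0 : (0 : ℝ) < N := by
    have : 0 < N := by omega
    exact_mod_cast this
  have hmean_pos : ∀ t ∈ Icc (0 : ℝ) T, 0 < (1 / N : ℝ) * ∑ i ∈ Finset.Icc 1 N, (x t i) ^ 2 :=
    fun t ht => mul_pos (by positivity) ((hinc t ht).sum_sq_pos hN)
  have h0 : (0 : ℝ) ∈ Icc (0 : ℝ) T := ⟨le_rfl, hT.le⟩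
  have hm0pos : 0 < m0 := (hmean_pos 0 h0).trans_le hm0
  have hE0 := (neg_log_le_heatEnergy hN (hinc 0 h0) hm0pos hm0).trans he0
  intro t ht
  have hbound : (1 / N : ℝ) * ∑ i ∈ Finset.Icc 1 N, (x t i) ^ 2 ≤
      8 * (e0 + Real.sqrt (56 * Real.pi * T / 3)) * T + 4 * m0 := by
    have hflow := sum_sq_le_of_flow hN hinc hvint hftc hincl ht
    calc (1 / N : ℝ) * ∑ i ∈ Finset.Icc 1 N, (x t i) ^ 2
        ≤ (1 / N : ℝ) * (∑ i ∈ Finset.Icc 1 N, (x 0 i) ^ 2 + 2 * t * N) := by gcongr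
      _ = (1 / N : ℝ) * ∑ i ∈ Finset.Icc 1 N, (x 0 i) ^ 2 + 2 * t := by field_simp
      _ ≤ m0 + 2 * T := by linarith [ht.2]
      _ ≤ 8 * (-(Real.log 12 + Real.log m0 / 2) + Real.sqrt (56 * Real.pi * T / 3)) * T
          + 4 * m0 := moment_le_of_log_bound hT hm0pos
      _ ≤ _ := by gcongr
  refine ⟨hbound, fun δ hδ => ?_⟩
  have hM := (hmean_pos t ht).trans_le hbound
  linarith [neg_log_le_heatEnergy hN (hinc t ht) hM hbound, log_twelve_add_half_log_le hM hδ]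
end

section
/- Let N ≥ 2, let x_1 < x_2 < ⋯ < x_N be real numbers, let ρ_N = (1/N) Σ_{i=1}^N χ_{B_i}/r_i be the associated piecewise constant density (where B_i is the open interval of length r_i centred at x_i), and let φ : ℝ → ℝ be Lipschitz with constant L. Then | ∫_ℝ φ(x) ρ_N(x) dx − (1/N) Σ_{i=1}^N φ(x_i) | ≤ 2L √(2 M_2 / N), where M_2 = (1/N) Σ_{i=1}^N x_i². -/
open MeasureTheory

/-- Averaging an `L`-Lipschitz function over an interval of length `r` centred at `c` changes its
value at `c` by at most `L * r / 2`. -/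
lemma abs_setIntegral_Ioo_div_sub_le {φ : ℝ → ℝ} {L : ℝ} (hL : 0 ≤ L) (hφ : Continuous φ)
    (hLip : ∀ a b, |φ a - φ b| ≤ L * |a - b|) (c : ℝ) {r : ℝ} (hr : 0 < r) :
    |(∫ y in Set.Ioo (c - r / 2) (c + r / 2), φ y * (1 / r)) - φ c| ≤ L * (r / 2) := by
  have hvol : volume.real (Set.Ioo (c - r / 2) (c + r / 2)) = r := by
    rw [Real.volume_real_Ioo_of_le (by linarith)]
    ring
  have hconst : φ c = ∫ _ in Set.Ioo (c - r / 2) (c + r / 2), φ c * (1 / r) := by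
    rw [setIntegral_const, hvol, smul_eq_mul]
    field_simp
  have hint : ∀ f : ℝ → ℝ, Continuous f →
      IntegrableOn f (Set.Ioo (c - r / 2) (c + r / 2)) := fun f hf =>
    (hf.integrableOn_Icc).mono_set Set.Ioo_subset_Icc_self
  have hsub : (∫ y in Set.Ioo (c - r / 2) (c + r / 2), φ y * (1 / r)) - φ c
      = ∫ y in Set.Ioo (c - r / 2) (c + r / 2), (φ y * (1 / r) - φ c * (1 / r)) := by
    rw [integral_sub (hint _ (by fun_prop)) (hint _ (by fun_prop)), ← hconst]
  rw [hsub, ← Real.norm_eq_abs]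
  have hbound : ∀ y ∈ Set.Ioo (c - r / 2) (c + r / 2),
      ‖φ y * (1 / r) - φ c * (1 / r)‖ ≤ L * (r / 2) * (1 / r) := by
    intro y hy
    rw [← sub_mul, Real.norm_eq_abs, abs_mul, abs_of_pos (one_div_pos.2 hr)]
    have hyc : |y - c| ≤ r / 2 := abs_le.2 ⟨by linarith [hy.1], by linarith [hy.2]⟩
    gcongr
    exact (hLip y c).trans (by gcongr)
  refine (norm_setIntegral_le_of_norm_le_const measure_Ioo_lt_top hbound).trans_eq ?_
  rw [hvol]
  field_simp

/-- Integrating a continuous function against a finite combination of indicators of bounded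
intervals. -/
lemma integral_mul_sum_indicator_Ioo {φ : ℝ → ℝ} (hφ : Continuous φ) (s : Finset ℕ)
    (k : ℝ) (a b w : ℕ → ℝ) :
    ∫ y, φ y * (k * ∑ i ∈ s, Set.indicator (Set.Ioo (a i) (b i)) (fun _ => w i) y)
      = k * ∑ i ∈ s, ∫ y in Set.Ioo (a i) (b i), φ y * w i := by
  have hfun : ∀ y, φ y * (k * ∑ i ∈ s, Set.indicator (Set.Ioo (a i) (b i)) (fun _ => w i) y)
      = k * ∑ i ∈ s, Set.indicator (Set.Ioo (a i) (b i)) (fun z => φ z * w i) y := by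
    intro y
    rw [mul_left_comm, Finset.mul_sum]
    simp only [Set.indicator_apply, mul_ite, mul_zero]
  simp only [hfun]
  rw [integral_const_mul, integral_finsetSum]
  · simp only [integral_indicator measurableSet_Ioo]
  · intro i _
    rw [integrable_indicator_iff measurableSet_Ioo]
    exact ((by fun_prop : Continuous fun z => φ z * w i).integrableOn_Icc).mono_set
      Set.Ioo_subset_Icc_self

/-- If each `r i` with `2 ≤ i` is at most the gap `x i - x (i - 1)`, the sum of the `r i`
telescopes. -/
lemma sum_Icc_le_add_sub {x r : ℕ → ℝ} {N : ℕ} (hN : 1 ≤ N)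
    (h : ∀ i, 1 ≤ i → i < N → r (i + 1) ≤ x (i + 1) - x i) :
    ∑ i ∈ Finset.Icc 1 N, r i ≤ r 1 + (x N - x 1) := by
  induction N, hN using Nat.le_induction with
  | base => simp
  | succ n hn ih =>
    rw [Finset.sum_Icc_succ_top (by omega)]
    linarith [ih fun i hi hin => h i hi (by omega), h n hn (by omega)]

/-- For `N ≥ 2` particles `x_1 < ⋯ < x_N` with the piecewise constant
density `ρ_N = (1/N) ∑ χ_{B_i}/r_i` and an `L`-Lipschitz function `φ`,
`|∫ φ ρ_N - (1/N) ∑ φ(x_i)| ≤ 2L √(2 M₂ / N)` where `M₂ = (1/N) ∑ x_i²`. -/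
theorem piecewise_density_weak_approx (N : ℕ) (hN : 2 ≤ N) (x : ℕ → ℝ)
    (hx : ∀ i, 1 ≤ i → i < N → x i < x (i + 1))
    (r : ℕ → ℝ)
    (hr1 : r 1 = x 2 - x 1)
    (hrN : r N = x N - x (N - 1))
    (hrmid : ∀ i, 2 ≤ i → i ≤ N - 1 → r i = min (x i - x (i - 1)) (x (i + 1) - x i))
    (φ : ℝ → ℝ) (L : ℝ) (hL : 0 ≤ L)
    (hLip : ∀ a b, |φ a - φ b| ≤ L * |a - b|) :
    |(∫ y : ℝ, φ y * ((1 / N : ℝ) * ∑ i ∈ Finset.Icc 1 N,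
        Set.indicator (Set.Ioo (x i - r i / 2) (x i + r i / 2)) (fun _ => 1 / r i) y))
      - (1 / N : ℝ) * ∑ i ∈ Finset.Icc 1 N, φ (x i)|
    ≤ 2 * L * Real.sqrt (2 * ((1 / N : ℝ) * ∑ i ∈ Finset.Icc 1 N, x i ^ 2) / N) := by
  have hφ : Continuous φ :=
    (LipschitzWith.of_dist_le_mul (K := ⟨L, hL⟩) fun a b => hLip a b).continuous
  have hN0 : (0 : ℝ) < N := by
    have : 0 < N := by omega
    exact_mod_cast this
  have hrpos : ∀ i ∈ Finset.Icc 1 N, 0 < r i := by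
    intro i hi
    obtain ⟨h1, h2⟩ := Finset.mem_Icc.1 hi
    rcases eq_or_ne i 1 with rfl | hi1
    · linarith [hx 1 le_rfl (by omega)]
    have hprev := hx (i - 1) (by omega) (by omega)
    rw [Nat.sub_add_cancel h1] at hprev
    rcases eq_or_ne i N with rfl | hiN
    · linarith
    rw [hrmid i (by omega) (by omega)]
    exact lt_min (by linarith) (by linarith [hx i h1 (by omega)])
  have hrle : ∀ i, 1 ≤ i → i < N → r (i + 1) ≤ x (i + 1) - x i := by
    intro i h1 h2
    rcases eq_or_ne (i + 1) N with rfl | hiN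
    · exact hrN.le
    · rw [hrmid (i + 1) (by omega) (by omega)]
      exact min_le_left _ _
  have hx2N : x 2 ≤ x N := by
    have hmono : ∀ n, 2 ≤ n → n ≤ N → x 2 ≤ x n := by
      intro n hn
      induction n, hn using Nat.le_induction with
      | base => exact fun _ => le_rfl
      | succ n hn ih =>
        exact fun h => (ih (by omega)).trans (hx n (by omega) (by omega)).le
    exact hmono N hN le_rfl
  have hrsum : ∑ i ∈ Finset.Icc 1 N, r i ≤ 2 * (x N - x 1) := by
    linarith [sum_Icc_le_add_sub (by omega) hrle]
  have hends : x 1 ^ 2 + x N ^ 2 ≤ ∑ i ∈ Finset.Icc 1 N, x i ^ 2 := by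
    rw [← Finset.sum_pair (f := fun i => x i ^ 2) (show 1 ≠ N by omega)]
    refine Finset.sum_le_sum_of_subset_of_nonneg ?_ fun i _ _ => sq_nonneg _
    intro i hi
    simp only [Finset.mem_insert, Finset.mem_singleton] at hi
    exact Finset.mem_Icc.2 (by omega)
  have hdiam : x N - x 1 ≤ Real.sqrt (2 * ∑ i ∈ Finset.Icc 1 N, x i ^ 2) :=
    Real.le_sqrt_of_sq_le (by nlinarith [sq_nonneg (x N + x 1)])
  have hsqrt : Real.sqrt (2 * ((1 / N : ℝ) * ∑ i ∈ Finset.Icc 1 N, x i ^ 2) / N)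
      = 1 / N * Real.sqrt (2 * ∑ i ∈ Finset.Icc 1 N, x i ^ 2) := by
    rw [← Real.sqrt_sq (one_div_pos.2 hN0).le, ← Real.sqrt_mul (sq_nonneg _),
      Real.sqrt_sq (one_div_pos.2 hN0).le]
    congr 1
    ring
  rw [integral_mul_sum_indicator_Ioo hφ, hsqrt, ← mul_sub, ← Finset.sum_sub_distrib, abs_mul,
    abs_of_pos (one_div_pos.2 hN0), mul_left_comm]
  refine mul_le_mul_of_nonneg_left ?_ (one_div_pos.2 hN0).le
  calc _ ≤ ∑ i ∈ Finset.Icc 1 N, L * (r i / 2) :=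
        (Finset.abs_sum_le_sum_abs _ _).trans <| Finset.sum_le_sum fun i hi =>
          abs_setIntegral_Ioo_div_sub_le hL hφ hLip (x i) (hrpos i hi)
    _ = L * ((∑ i ∈ Finset.Icc 1 N, r i) / 2) := by rw [← Finset.mul_sum, Finset.sum_div]
    _ ≤ L * (2 * Real.sqrt (2 * ∑ i ∈ Finset.Icc 1 N, x i ^ 2)) := by
        gcongr
        linarith [Real.sqrt_nonneg (2 * ∑ i ∈ Finset.Icc 1 N, x i ^ 2)]
    _ = 2 * L * Real.sqrt (2 * ∑ i ∈ Finset.Icc 1 N, x i ^ 2) := by ring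
end

section
/- Let H ∈ C^∞((0,∞)) ∩ C⁰([0,∞)) be convex with H(0) = 0, such that h(s) = s H(1/s) is convex and non-increasing on (0,∞). Let r > 0 and let ρ : [−r,r] → (0,∞) be a C¹ probability density with inverse cumulative distribution function Φ, and for N ≥ 3 set x_1 = Φ(0), x_i = Φ(i/N) for i = 2,…,N. Then there exists a constant K > 0, depending only on ρ and H, such that for all N ≥ 3 the discrete energy satisfies (1/N) Σ_{i=1}^N h(N r_i) ≤ ∫_{−r}^{r} H(ρ(x)) dx + K/N; in particular limsup_{N→∞} (1/N) Σ_{i=1}^N h(N r_i) ≤ ∫_{−r}^{r} H(ρ(x)) dx. -/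
open MeasureTheory

/-- The particles `x_1 = Φ(0)`, `x_i = Φ(i/N)` for `i = 2,…,N`. -/
noncomputable def partPt (N : ℕ) (Φ : ℝ → ℝ) (i : ℕ) : ℝ :=
  if i = 1 then Φ 0 else Φ ((i : ℝ) / N)

/-- Ball radius `r_i = min(Δx_i, Δx_{i+1})` (conventions `r_1 = Δx_2`, `r_N = Δx_N`)
for the particles `partPt N Φ`. -/
noncomputable def discRad (N : ℕ) (Φ : ℝ → ℝ) (i : ℕ) : ℝ :=
  if i = 1 then partPt N Φ 2 - partPt N Φ 1
  else if i = N then partPt N Φ N - partPt N Φ (N - 1)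
  else min (partPt N Φ i - partPt N Φ (i - 1)) (partPt N Φ (i + 1) - partPt N Φ i)

/-- Each radius is bounded below by the length of a neighbouring cell of the uniform quantile
partition. -/
lemma exists_cell_le_discRad {N k : ℕ} {Φ : ℝ → ℝ} (hN : 3 ≤ N) (hk : k < N)
    (hΦ : MonotoneOn Φ (Set.Icc 0 1)) :
    ∃ j < N, j ≤ k + 1 ∧ k ≤ j + 1 ∧
      Φ (((j + 1 : ℕ) : ℝ) / N) - Φ ((j : ℝ) / N) ≤ discRad N Φ (k + 1) := by
  have hN0 : (0 : ℝ) < N := by exact_mod_cast (by omega : 0 < N)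
  have hN3 : (3 : ℝ) ≤ N := by exact_mod_cast hN
  have h1 : (1 : ℝ) / N ∈ Set.Icc (0 : ℝ) 1 :=
    ⟨by positivity, by rw [div_le_one hN0]; linarith⟩
  have h2 : (2 : ℝ) / N ∈ Set.Icc (0 : ℝ) 1 :=
    ⟨by positivity, by rw [div_le_one hN0]; linarith⟩
  have h01 : Φ 0 ≤ Φ (1 / N) := hΦ (by simp) h1 h1.1
  have h12 : Φ (1 / N) ≤ Φ (2 / N) := hΦ h1 h2 (by gcongr; norm_num)
  rcases Nat.eq_zero_or_pos k with rfl | hk0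
  · refine ⟨0, by omega, by omega, by omega, ?_⟩
    simp only [discRad, partPt]
    norm_num at h12 ⊢
    linarith
  by_cases hkN : k + 1 = N
  · refine ⟨k, hk, by omega, by omega, ?_⟩
    have hk1 : k ≠ 1 := by omega
    subst hkN
    simp [discRad, partPt, hk0.ne', hk1]
  have hdisc : discRad N Φ (k + 1) = min (partPt N Φ (k + 1) - partPt N Φ k)
      (partPt N Φ (k + 2) - partPt N Φ (k + 1)) := by
    simp [discRad, hk0.ne', hkN]
  rcases min_choice (partPt N Φ (k + 1) - partPt N Φ k)
    (partPt N Φ (k + 2) - partPt N Φ (k + 1)) with h | h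
  · refine ⟨k, hk, by omega, by omega, ?_⟩
    rw [hdisc, h]
    by_cases hk1 : k = 1
    · subst hk1
      norm_num [partPt] at h01 ⊢
      linarith
    · simp [partPt, hk0.ne', hk1]
  · refine ⟨k + 1, by omega, by omega, by omega, ?_⟩
    rw [hdisc, h]
    simp [partPt, hk0.ne', add_assoc, one_add_one_eq_two]

/-- A convex function on `(0,∞)` decreases at most linearly away from the origin. -/
lemma ConvexOn.sub_le_of_le {h : ℝ → ℝ} (hh : ConvexOn ℝ (Set.Ioi 0) h) {a s t : ℝ}
    (ha : 0 < a) (hs : a ≤ s) (hst : s ≤ t) :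
    h s - h t ≤ (h (a / 2) - h a) / (a / 2) * (t - s) := by
  rcases hst.eq_or_lt with rfl | hst
  · simp
  have ha2 : a / 2 < a := by linarith
  have hsec := hh.secant_mono (a := a / 2) (x := a) (y := s) (half_pos ha) ha
    (ha.trans_le hs) ha2.ne' (ha2.trans_le hs).ne' hs
  have hadj := hh.slope_mono_adjacent (x := a / 2) (y := s) (z := t) (half_pos ha)
    ((ha.trans_le hs).trans hst) (ha2.trans_le hs) hst
  have hle := hsec.trans hadj
  rw [le_div_iff₀ (sub_pos.2 hst), sub_half] at hle
  have : (h (a / 2) - h a) / (a / 2) = -((h a - h (a / 2)) / (a / 2)) := by ring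
  rw [this]
  linarith

/-- The energy bound on one cell: if `Δ` is the length of an interval of mass `1/N` on which `ρ`
exceeds its value at `x` by at most `δ`, then `h (N R) ρ(x)` is at most `H (ρ x)` up to `δ`, for
any `R ≥ Δ`. -/
lemma mul_cell_le {H h : ℝ → ℝ} (hh : ∀ s : ℝ, 0 < s → h s = s * H (1 / s))
    (hconv : ConvexOn ℝ (Set.Ioi 0) h) (hanti : AntitoneOn h (Set.Ioi 0))
    {m M p δ Δ R N : ℝ} (hm : 0 < m) (hmp : m ≤ p) (hpM : p ≤ M) (hδ : 0 ≤ δ) (hN : 0 < N)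
    (hlow : 1 / N ≤ M * Δ) (hup : m * Δ ≤ 1 / N) (hΔ : 1 / N ≤ (p + δ) * Δ) (hR : Δ ≤ R) :
    h (N * R) * p ≤ H p + (h (1 / M / 2) - h (1 / M)) / (1 / M / 2) * (δ / m ^ 2) * p := by
  have hp : 0 < p := hm.trans_le hmp
  have hM : 0 < M := hp.trans_le hpM
  rw [div_le_iff₀ hN] at hlow hΔ
  rw [le_div_iff₀ hN] at hup
  have hlow' : 1 / M ≤ N * Δ := by rw [div_le_iff₀ hM]; linarith
  have hup' : N * Δ ≤ 1 / m := by rw [le_div_iff₀ hm]; linarith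
  have hM1 : 0 < 1 / M := by positivity
  have hNΔ : 0 < N * Δ := hM1.trans_le hlow'
  have hC : 0 ≤ (h (1 / M / 2) - h (1 / M)) / (1 / M / 2) := by
    have := hanti (half_pos hM1) hM1 (half_le_self hM1.le)
    have := sub_nonneg.2 this
    positivity
  have hclose : 1 / p - N * Δ ≤ δ / m ^ 2 := by
    have h1 : 1 / p ≤ N * Δ + N * Δ * δ / p := by
      rw [div_le_iff₀ hp, add_mul, div_mul_cancel₀ _ hp.ne']
      linarith
    have h2 : N * Δ * δ / p ≤ 1 / m * δ / m := by gcongr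
    have h3 : 1 / m * δ / m = δ / m ^ 2 := by field_simp
    linarith
  have hRΔ : h (N * R) ≤ h (N * Δ) :=
    hanti hNΔ (hNΔ.trans_le (by gcongr)) (by gcongr)
  have hHp : h (1 / p) * p = H p := by
    rw [hh _ (by positivity), one_div_one_div]
    field_simp
  have hmain : h (N * Δ) ≤
      h (1 / p) + (h (1 / M / 2) - h (1 / M)) / (1 / M / 2) * (δ / m ^ 2) := by
    have hpos : 0 ≤ δ / m ^ 2 := by positivity
    rcases le_total (1 / p) (N * Δ) with hle | hle
    · have := hanti (show (0 : ℝ) < 1 / p by positivity) hNΔ hle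
      have := mul_nonneg hC hpos
      linarith
    · have := hconv.sub_le_of_le hM1 hlow' hle
      have := mul_le_mul_of_nonneg_left hclose hC
      linarith
  rw [← hHp, ← add_mul]
  exact mul_le_mul_of_nonneg_right (hRΔ.trans hmain) hp.le

/-- The mass of a subinterval compared with its length, given pointwise bounds on the density. -/
lemma mul_le_integral_le_mul {ρ : ℝ → ℝ} {a b m M : ℝ} (hab : a ≤ b)
    (hρ : ContinuousOn ρ (Set.Icc a b)) (hlow : ∀ y ∈ Set.Icc a b, m ≤ ρ y)
    (hup : ∀ y ∈ Set.Icc a b, ρ y ≤ M) :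
    m * (b - a) ≤ ∫ t in a..b, ρ t ∧ ∫ t in a..b, ρ t ≤ M * (b - a) := by
  have hint := hρ.intervalIntegrable_of_Icc hab (μ := volume)
  constructor
  · have := intervalIntegral.integral_mono_on hab intervalIntegrable_const hint hlow
    rw [intervalIntegral.integral_const, smul_eq_mul] at this
    linarith
  · have := intervalIntegral.integral_mono_on hab hint intervalIntegrable_const hup
    rw [intervalIntegral.integral_const, smul_eq_mul] at this
    linarith

/-- The energy bound with rate `1/N`. -/
lemma exists_discrete_energy_le (H h ρ Φ : ℝ → ℝ) (r : ℝ) (hr : 0 < r)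
    (hHcont : ContinuousOn H (Set.Ici 0))
    (hh : ∀ s : ℝ, 0 < s → h s = s * H (1 / s))
    (hhconv : ConvexOn ℝ (Set.Ioi 0) h)
    (hhmono : AntitoneOn h (Set.Ioi 0))
    (hρC1 : ContDiffOn ℝ 1 ρ (Set.Icc (-r) r))
    (hρpos : ∀ y ∈ Set.Icc (-r) r, 0 < ρ y)
    (hρmass : ∫ t in (-r)..r, ρ t = 1)
    (hΦmem : ∀ η ∈ Set.Icc (0 : ℝ) 1, Φ η ∈ Set.Icc (-r) r)
    (hΦinv : ∀ η ∈ Set.Icc (0 : ℝ) 1, ∫ t in (-r)..(Φ η), ρ t = η) :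
    ∃ K : ℝ, 0 < K ∧ ∀ N : ℕ, 3 ≤ N →
      (1 / N : ℝ) * ∑ i ∈ Finset.Icc 1 N, h ((N : ℝ) * discRad N Φ i)
        ≤ (∫ t in (-r)..r, H (ρ t)) + K / N := by
  have hcont : ContinuousOn ρ (Set.Icc (-r) r) := hρC1.continuousOn
  have hne : (Set.Icc (-r) r).Nonempty := ⟨0, by constructor <;> linarith⟩
  obtain ⟨y₀, hy₀, hmin⟩ := isCompact_Icc.exists_isMinOn hne hcont
  obtain ⟨y₁, hy₁, hmax⟩ := isCompact_Icc.exists_isMaxOn hne hcont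
  obtain ⟨L, hL⟩ := hρC1.exists_lipschitzOnWith one_ne_zero (convex_Icc _ _) isCompact_Icc
  set m := ρ y₀ with hm_def
  set M := ρ y₁ with hM_def
  have hm : 0 < m := hρpos _ hy₀
  have hlow : ∀ y ∈ Set.Icc (-r) r, m ≤ ρ y := fun y hy => hmin hy
  have hup : ∀ y ∈ Set.Icc (-r) r, ρ y ≤ M := fun y hy => hmax hy
  have hint : ∀ {a b : ℝ}, a ∈ Set.Icc (-r) r → b ∈ Set.Icc (-r) r →
      IntervalIntegrable ρ volume a b := fun ha hb =>
    (hcont.mono (Set.uIcc_subset_Icc ha hb)).intervalIntegrable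
  have hHρ : ContinuousOn (fun t => H (ρ t)) (Set.Icc (-r) r) :=
    hHcont.comp hcont fun y hy => (hρpos y hy).le
  have hHint : ∀ {a b : ℝ}, a ∈ Set.Icc (-r) r → b ∈ Set.Icc (-r) r →
      IntervalIntegrable (fun t => H (ρ t)) volume a b := fun ha hb =>
    (hHρ.mono (Set.uIcc_subset_Icc ha hb)).intervalIntegrable
  have hl : -r ∈ Set.Icc (-r) r := ⟨le_rfl, by linarith⟩
  have hu : r ∈ Set.Icc (-r) r := ⟨by linarith, le_rfl⟩
  have hmass : ∀ {a b : ℝ}, a ∈ Set.Icc (0 : ℝ) 1 → b ∈ Set.Icc (0 : ℝ) 1 →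
      ∫ t in (Φ a)..(Φ b), ρ t = b - a := fun {a b} ha hb => by
    rw [← intervalIntegral.integral_interval_sub_left (hint hl (hΦmem b hb))
      (hint hl (hΦmem a ha)), hΦinv a ha, hΦinv b hb]
  have hbounds : ∀ {a b : ℝ}, a ∈ Set.Icc (-r) r → b ∈ Set.Icc (-r) r → a ≤ b →
      m * (b - a) ≤ ∫ t in a..b, ρ t ∧ ∫ t in a..b, ρ t ≤ M * (b - a) := fun ha hb hab =>
    have hsub := Set.Icc_subset_Icc ha.1 hb.2
    mul_le_integral_le_mul hab (hcont.mono hsub) (fun y hy => hlow y (hsub hy))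
      fun y hy => hup y (hsub hy)
  have hΦmono : MonotoneOn Φ (Set.Icc 0 1) := fun a ha b hb hab => by
    by_contra! hlt
    have := (hbounds (hΦmem b hb) (hΦmem a ha) hlt.le).1
    rw [hmass hb ha] at this
    nlinarith [mul_pos hm (sub_pos.2 hlt)]
  have hΦ0 : Φ 0 = -r := by
    have h0 : (0 : ℝ) ∈ Set.Icc (0 : ℝ) 1 := by simp
    have := (hbounds hl (hΦmem 0 h0) (hΦmem 0 h0).1).1
    rw [hΦinv 0 h0] at this
    exact le_antisymm (by nlinarith) (hΦmem 0 h0).1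
  have hΦ1 : Φ 1 = r := by
    have h1 : (1 : ℝ) ∈ Set.Icc (0 : ℝ) 1 := by simp
    have := (hbounds (hΦmem 1 h1) hu (hΦmem 1 h1).2).1
    rw [← intervalIntegral.integral_interval_sub_left (hint hl hu) (hint hl (hΦmem 1 h1)),
      hΦinv 1 h1, hρmass] at this
    exact le_antisymm (hΦmem 1 h1).2 (by nlinarith)
  set C := (h (1 / M / 2) - h (1 / M)) / (1 / M / 2) with hC_def
  refine ⟨max (C * (L * (3 / m) / m ^ 2)) 1, by positivity, fun N hN => ?_⟩
  have hN0 : (0 : ℝ) < N := by exact_mod_cast (by omega : 0 < N)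
  set y : ℕ → ℝ := fun k => Φ ((k : ℝ) / N) with hy_def
  have hmem : ∀ {k : ℕ}, k ≤ N → (k : ℝ) / N ∈ Set.Icc (0 : ℝ) 1 := fun {k} hk =>
    ⟨by positivity, by rw [div_le_one hN0]; exact_mod_cast hk⟩
  have hymem : ∀ {k : ℕ}, k ≤ N → y k ∈ Set.Icc (-r) r := fun hk => hΦmem _ (hmem hk)
  have hymono : ∀ {j k : ℕ}, j ≤ k → k ≤ N → y j ≤ y k := fun hjk hk =>
    hΦmono (hmem (hjk.trans hk)) (hmem hk) (by gcongr)
  have hymass : ∀ {j k : ℕ}, j ≤ N → k ≤ N →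
      ∫ t in (y j)..(y k), ρ t = ((k : ℝ) - j) / N := fun hj hk => by
    rw [hmass (hmem hj) (hmem hk), sub_div]
  have hycell : ∀ {j : ℕ}, j < N → ∫ t in (y j)..(y (j + 1)), ρ t = 1 / N := fun {j} hj => by
    rw [hymass hj.le hj]
    push_cast
    ring
  have hydist : ∀ {j k : ℕ}, j ≤ k → k ≤ N → k ≤ j + 3 → y k - y j ≤ 3 / m / N :=
      fun {j k} hjk hk hkj => by
    have h1 := (hbounds (hymem (hjk.trans hk)) (hymem hk) (hymono hjk hk)).1
    rw [hymass (hjk.trans hk) hk] at h1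
    have h2 : ((k : ℝ) - j) / N ≤ 3 / N := by
      gcongr
      have : (k : ℝ) ≤ j + 3 := by exact_mod_cast hkj
      linarith
    rw [div_right_comm, le_div_iff₀ hm]
    linarith
  have hcell : ∀ k ∈ Finset.range N, 1 / (N : ℝ) * h (N * discRad N Φ (k + 1)) ≤
      (∫ t in (y k)..(y (k + 1)), H (ρ t)) + C * (L * (3 / m / N) / m ^ 2) * (1 / N) := by
    intro k hk
    rw [Finset.mem_range] at hk
    obtain ⟨j, hj, hjk, hkj, hR⟩ := exists_cell_le_discRad hN hk hΦmono
    have hkk := hymono (Nat.le_succ k) hk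
    have hjj := hymono (Nat.le_succ j) hj
    have hjb := hbounds (hymem hj.le) (hymem hj) hjj
    rw [hycell hj] at hjb
    have hspread : ∀ t ∈ Set.Icc (y j) (y (j + 1)), ∀ x ∈ Set.Icc (y k) (y (k + 1)),
        |t - x| ≤ 3 / m / N := by
      intro t ht x hx
      rw [abs_le]
      have hA : y (k + 1) - y j ≤ 3 / m / N := hydist hjk hk (by omega)
      have hB : y (j + 1) - y k ≤ 3 / m / N := hydist (by omega) hj (by omega)
      constructor <;> linarith [ht.1, ht.2, hx.1, hx.2]
    have hpt : ∀ x ∈ Set.Icc (y k) (y (k + 1)),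
        h (N * discRad N Φ (k + 1)) * ρ x ≤
          H (ρ x) + C * (L * (3 / m / N) / m ^ 2) * ρ x := by
      intro x hx
      have hxr := Set.Icc_subset_Icc (hymem hk.le).1 (hymem hk).2 hx
      have hsub := Set.Icc_subset_Icc (hymem hj.le).1 (hymem hj).2
      refine mul_cell_le hh hhconv hhmono hm (hlow x hxr) (hup x hxr) (by positivity) hN0
        hjb.2 hjb.1 ?_ hR
      rw [← hycell hj]
      refine (mul_le_integral_le_mul hjj (hcont.mono hsub) (fun t ht => hlow t (hsub ht))
        fun t ht => ?_).2
      have hLip := hL.dist_le_mul t (hsub ht) x hxr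
      rw [Real.dist_eq, Real.dist_eq] at hLip
      have := (le_abs_self _).trans (hLip.trans
        (mul_le_mul_of_nonneg_left (hspread t ht x hx) L.coe_nonneg))
      linarith
    have hρk := hint (hymem hk.le) (hymem hk)
    have := intervalIntegral.integral_mono_on hkk (hρk.const_mul _)
      ((hHint (hymem hk.le) (hymem hk)).add (hρk.const_mul _)) hpt
    rw [intervalIntegral.integral_add (hHint (hymem hk.le) (hymem hk)) (hρk.const_mul _),
      intervalIntegral.integral_const_mul, intervalIntegral.integral_const_mul,
      hycell hk] at this
    linarith
  have hsum := Finset.sum_le_sum hcell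
  rw [Finset.sum_add_distrib, intervalIntegral.sum_integral_adjacent_intervals
    (fun k hk => hHint (hymem hk.le) (hymem hk)), ← Finset.mul_sum, Finset.sum_const,
    Finset.card_range, nsmul_eq_mul] at hsum
  have hy0 : y 0 = -r := by simp [hy_def, hΦ0]
  have hyN : y N = r := by simp [hy_def, hN0.ne', hΦ1]
  have hindex : ∑ i ∈ Finset.Icc 1 N, h ((N : ℝ) * discRad N Φ i) =
      ∑ k ∈ Finset.range N, h (N * discRad N Φ (k + 1)) := by
    rw [Finset.range_eq_Ico, Finset.sum_Ico_add' (fun i => h ((N : ℝ) * discRad N Φ i))]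
    rfl
  have hconst : (N : ℝ) * (C * (L * (3 / m / N) / m ^ 2) * (1 / N)) =
      C * (L * (3 / m) / m ^ 2) / N := by
    field_simp
  rw [hy0, hyN, hconst] at hsum
  rw [hindex]
  refine hsum.trans ?_
  gcongr
  exact le_max_left _ _

/-- For `H` smooth on `(0,∞)`, continuous on `[0,∞)`, convex, `H(0) = 0`,
with `h(s) = s H(1/s)` convex and non-increasing on `(0,∞)`, and `ρ` a `C¹` positive
probability density on `[-r,r]` with inverse CDF `Φ`, the discrete energy of the
particles `x_1 = Φ(0)`, `x_i = Φ(i/N)` satisfies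
`(1/N) ∑ h(N r_i) ≤ ∫_{-r}^r H(ρ) + K/N` for some constant `K > 0` and all `N ≥ 3`;
in particular `limsup_N (1/N) ∑ h(N r_i) ≤ ∫_{-r}^r H(ρ)`. -/
theorem discrete_energy_limsup (H h ρ Φ : ℝ → ℝ) (r : ℝ) (hr : 0 < r)
    (hHcont : ContinuousOn H (Set.Ici 0))
    (hHsmooth : ContDiffOn ℝ (⊤ : ℕ∞) H (Set.Ioi 0))
    (hHconv : ConvexOn ℝ (Set.Ici 0) H)
    (hH0 : H 0 = 0)
    (hh : ∀ s : ℝ, 0 < s → h s = s * H (1 / s))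
    (hhconv : ConvexOn ℝ (Set.Ioi 0) h)
    (hhmono : AntitoneOn h (Set.Ioi 0))
    (hρC1 : ContDiffOn ℝ 1 ρ (Set.Icc (-r) r))
    (hρpos : ∀ y ∈ Set.Icc (-r) r, 0 < ρ y)
    (hρmass : ∫ t in (-r)..r, ρ t = 1)
    (hΦmem : ∀ η ∈ Set.Icc (0 : ℝ) 1, Φ η ∈ Set.Icc (-r) r)
    (hΦinv : ∀ η ∈ Set.Icc (0 : ℝ) 1, ∫ t in (-r)..(Φ η), ρ t = η) :
    (∃ K : ℝ, 0 < K ∧ ∀ N : ℕ, 3 ≤ N →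
      (1 / N : ℝ) * ∑ i ∈ Finset.Icc 1 N, h ((N : ℝ) * discRad N Φ i)
        ≤ (∫ t in (-r)..r, H (ρ t)) + K / N) ∧
    ∀ ε : ℝ, 0 < ε → ∃ N₀ : ℕ, ∀ N : ℕ, N₀ ≤ N →
      (1 / N : ℝ) * ∑ i ∈ Finset.Icc 1 N, h ((N : ℝ) * discRad N Φ i)
        ≤ (∫ t in (-r)..r, H (ρ t)) + ε := by
  obtain ⟨K, hK, hbound⟩ := exists_discrete_energy_le H h ρ Φ r hr hHcont hh hhconv hhmono hρC1
    hρpos hρmass hΦmem hΦinv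
  refine ⟨⟨K, hK, hbound⟩, fun ε hε => ⟨max 3 ⌈K / ε⌉₊, fun N hN => ?_⟩⟩
  have hN3 : 3 ≤ N := (le_max_left _ _).trans hN
  have hN0 : (0 : ℝ) < N := by exact_mod_cast (by omega : 0 < N)
  have hKN : K / ε ≤ N := Nat.ceil_le.1 ((le_max_right _ _).trans hN)
  have : K / N ≤ ε := by
    rw [div_le_iff₀ hε] at hKN
    rw [div_le_iff₀ hN0]
    linarith
  linarith [hbound N hN3]
end

section
/- Let H : [0,∞) → ℝ be convex and continuous with H(0) = 0, and suppose there exist continuous functions f_1, f_2 : [0,∞) → ℝ with f_1(1) = 1 and f_2(1) = 0 such that H(αx) ≤ f_1(α) H(x) + f_2(α) x for all x, α ≥ 0. Let ρ : ℝ → [0,∞) be a probability density with H ∘ ρ ∈ L¹(ℝ), let S = supp ρ, and for δ > 0 set G_δ(x) = exp(−x²/(2δ²))/(δ√(2π)), S_δ = S ∩ [−1/δ, 1/δ], g_δ = ∫_{S_δ} (G_δ ∗ ρ)(x) dx, and ρ_δ = χ_{S_δ} (G_δ ∗ ρ)/g_δ (for δ small enough that g_δ > 0). Then g_δ → 1 as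 δ → 0 and limsup_{δ→0} ∫_ℝ H(ρ_δ(x)) dx ≤ ∫_ℝ H(ρ(x)) dx. -/
open MeasureTheory

/-- The Gaussian mollification `(G_δ ∗ ρ)(x)`. -/
noncomputable def gaussConv (δ : ℝ) (ρ : ℝ → ℝ) (x : ℝ) : ℝ :=
  ∫ y : ℝ, Real.exp (-(x - y) ^ 2 / (2 * δ ^ 2)) / (δ * Real.sqrt (2 * Real.pi)) * ρ y

/-- The truncated support `S_δ = supp ρ ∩ [-1/δ, 1/δ]`. -/
noncomputable def truncSupp (δ : ℝ) (ρ : ℝ → ℝ) : Set ℝ :=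
  tsupport ρ ∩ Set.Icc (-(1 / δ)) (1 / δ)

/-- The normalising mass `g_δ = ∫_{S_δ} G_δ ∗ ρ`. -/
noncomputable def gaussMass (δ : ℝ) (ρ : ℝ → ℝ) : ℝ :=
  ∫ x in truncSupp δ ρ, gaussConv δ ρ x

/-- The mollified density `ρ_δ = χ_{S_δ} (G_δ ∗ ρ)/g_δ`. -/
noncomputable def mollified (δ : ℝ) (ρ : ℝ → ℝ) (x : ℝ) : ℝ :=
  (truncSupp δ ρ).indicator (fun x' => gaussConv δ ρ x' / gaussMass δ ρ) x

open Filter Topology ProbabilityTheory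

lemma isCompact_truncSupp (δ : ℝ) (ρ : ℝ → ℝ) : IsCompact (truncSupp δ ρ) :=
  isCompact_Icc.inter_left (isClosed_tsupport ρ)

lemma measurableSet_truncSupp (δ : ℝ) (ρ : ℝ → ℝ) : MeasurableSet (truncSupp δ ρ) :=
  (isCompact_truncSupp δ ρ).measurableSet

lemma abs_gaussKernel_mul_le {δ : ℝ} (hδ : 0 < δ) (u t : ℝ) :
    ‖Real.exp (-u ^ 2 / (2 * δ ^ 2)) / (δ * √(2 * Real.pi)) * t‖ ≤
      1 / (δ * √(2 * Real.pi)) * ‖t‖ := by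
  rw [norm_mul, Real.norm_of_nonneg (by positivity)]
  gcongr
  rw [Real.exp_le_one_iff]
  exact div_nonpos_of_nonpos_of_nonneg (neg_nonpos.2 (sq_nonneg u)) (by positivity)

lemma aestronglyMeasurable_gaussKernel_mul {φ : ℝ → ℝ} (hφ : Integrable φ) (δ x : ℝ) :
    AEStronglyMeasurable
      (fun y => Real.exp (-(x - y) ^ 2 / (2 * δ ^ 2)) / (δ * √(2 * Real.pi)) * φ y) :=
  (Continuous.aestronglyMeasurable (by fun_prop)).mul hφ.aestronglyMeasurable

lemma continuous_gaussConv {φ : ℝ → ℝ} (hφ : Integrable φ) {δ : ℝ} (hδ : 0 < δ) :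
    Continuous (gaussConv δ φ) := by
  refine continuous_of_dominated (aestronglyMeasurable_gaussKernel_mul hφ δ)
    (bound := fun y => 1 / (δ * √(2 * Real.pi)) * ‖φ y‖)
    (fun x => ae_of_all _ fun y => abs_gaussKernel_mul_le hδ _ _) (hφ.norm.const_mul _)
    (ae_of_all _ fun y => by fun_prop)

lemma gaussConv_nonneg {φ : ℝ → ℝ} (hφ : ∀ x, 0 ≤ φ x) {δ : ℝ} (hδ : 0 < δ) (x : ℝ) :
    0 ≤ gaussConv δ φ x :=
  integral_nonneg fun y => mul_nonneg (by positivity) (hφ y)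

lemma sq_toNNReal_ne_zero {δ : ℝ} (hδ : 0 < δ) : (δ ^ 2).toNNReal ≠ 0 := by
  simpa using hδ.ne'

lemma gaussianPDFReal_sq_toNNReal {δ : ℝ} (hδ : 0 < δ) (x y : ℝ) :
    gaussianPDFReal x (δ ^ 2).toNNReal y =
      Real.exp (-(x - y) ^ 2 / (2 * δ ^ 2)) / (δ * √(2 * Real.pi)) := by
  rw [gaussianPDFReal_def]
  simp only [Real.coe_toNNReal _ (sq_nonneg δ)]
  rw [Real.sqrt_mul (by positivity), Real.sqrt_sq hδ.le, mul_comm δ,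
    ← neg_sub y x, neg_sq, div_eq_inv_mul (Real.exp _)]

/-- The Gaussian mollification as an expectation. -/
lemma gaussConv_eq_integral_gaussianReal (φ : ℝ → ℝ) {δ : ℝ} (hδ : 0 < δ) (x : ℝ) :
    gaussConv δ φ x = ∫ y, φ y ∂gaussianReal x (δ ^ 2).toNNReal := by
  rw [integral_gaussianReal_eq_integral_smul (sq_toNNReal_ne_zero hδ)]
  simp only [gaussianPDFReal_sq_toNNReal hδ, smul_eq_mul, gaussConv]

lemma integrable_gaussianReal_of_integrable {φ : ℝ → ℝ} (hφ : Integrable φ) {δ : ℝ} (hδ : 0 < δ)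
    (x : ℝ) : Integrable φ (gaussianReal x (δ ^ 2).toNNReal) := by
  rw [gaussianReal_of_var_ne_zero _ (sq_toNNReal_ne_zero hδ),
    integrable_withDensity_iff_integrable_smul' (measurable_gaussianPDF _ _)
      (ae_of_all _ fun _ => gaussianPDF_lt_top)]
  simp only [toReal_gaussianPDF, gaussianPDFReal_sq_toNNReal hδ, smul_eq_mul]
  exact (hφ.norm.const_mul _).mono' (aestronglyMeasurable_gaussKernel_mul hφ δ x)
    (ae_of_all _ fun y => abs_gaussKernel_mul_le hδ _ _)

lemma gaussConv_eq_integral_standardGaussian {φ : ℝ → ℝ} (hφ : Integrable φ) {δ : ℝ} (hδ : 0 < δ)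
    (x : ℝ) : gaussConv δ φ x = ∫ z, φ (x + δ * z) ∂gaussianReal 0 1 := by
  have hmap : (gaussianReal 0 1).map (fun z => x + δ * z) = gaussianReal x (δ ^ 2).toNNReal := by
    have : (fun z : ℝ => x + δ * z) = (x + ·) ∘ (δ * ·) := rfl
    rw [this, ← Measure.map_map (by fun_prop) (by fun_prop), gaussianReal_map_const_mul,
      gaussianReal_map_const_add]
    congr 1
    · simp
    · ext; simp [sq_nonneg]
  rw [gaussConv_eq_integral_gaussianReal φ hδ, ← hmap, integral_map (by fun_prop)]
  rw [hmap]
  exact (integrable_gaussianReal_of_integrable hφ hδ x).aestronglyMeasurable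

/-- **Jensen's inequality** for the Gaussian mollification. -/
lemma ConvexOn.map_gaussConv_le {H ρ : ℝ → ℝ} (hH : ConvexOn ℝ (Set.Ici 0) H)
    (hHc : ContinuousOn H (Set.Ici 0)) (hρ : ∀ x, 0 ≤ ρ x) (hint : Integrable ρ)
    (hHρ : Integrable fun x => H (ρ x)) {δ : ℝ} (hδ : 0 < δ) (x : ℝ) :
    H (gaussConv δ ρ x) ≤ gaussConv δ (fun y => H (ρ y)) x := by
  rw [gaussConv_eq_integral_gaussianReal _ hδ, gaussConv_eq_integral_gaussianReal _ hδ]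
  exact hH.map_integral_le hHc isClosed_Ici (ae_of_all _ hρ)
    (integrable_gaussianReal_of_integrable hint hδ x)
    (integrable_gaussianReal_of_integrable hHρ hδ x)

/-- Translation is continuous in `L¹`. -/
lemma tendsto_integral_norm_translate_sub {φ : ℝ → ℝ} (hφ : Integrable φ) :
    Tendsto (fun h => ∫ x, ‖φ (x + h) - φ x‖) (𝓝 0) (𝓝 0) := by
  let T : ℝ → C(ℝ, ℝ) := fun h => ⟨fun x => x + h, by fun_prop⟩
  have hT : Continuous T :=
    (ContinuousMap.curry ⟨fun p : ℝ × ℝ => p.2 + p.1, by fun_prop⟩).continuous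
  have hTm : ∀ h, MeasurePreserving (T h) volume volume := fun h =>
    measurePreserving_add_right volume h
  have hφ1 : MemLp φ 1 := memLp_one_iff_integrable.2 hφ
  have hlim : Continuous fun h => Lp.compMeasurePreserving (T h) (hTm h) (hφ1.toLp φ) :=
    continuous_const.compMeasurePreservingLp hT hTm ENNReal.one_ne_top
  have h0 := (tendsto_iff_norm_sub_tendsto_zero.1 (hlim.tendsto 0))
  refine h0.congr fun h => ?_
  rw [L1.norm_eq_integral_norm]
  refine integral_congr_ae ?_
  rw [Lp.toLp_compMeasurePreserving, Lp.toLp_compMeasurePreserving]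
  filter_upwards [Lp.coeFn_sub ((hφ1.comp_measurePreserving (hTm h)).toLp _)
      ((hφ1.comp_measurePreserving (hTm 0)).toLp _),
    (hφ1.comp_measurePreserving (hTm h)).coeFn_toLp,
    (hφ1.comp_measurePreserving (hTm 0)).coeFn_toLp] with x h1 h2 h3
  rw [h1, Pi.sub_apply, h2, h3]
  simp [T]

lemma integrable_prod_translate {φ : ℝ → ℝ} (hφ : Integrable φ) (δ : ℝ) :
    Integrable (fun p : ℝ × ℝ => φ (p.2 + δ * p.1)) ((gaussianReal 0 1).prod volume) := by
  have hmp : MeasurePreserving (fun p : ℝ × ℝ => (p.1, p.2 + δ * p.1))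
      ((gaussianReal 0 1).prod volume) ((gaussianReal 0 1).prod volume) :=
    (MeasurePreserving.id _).skew_product (g := fun z x => x + δ * z) (by fun_prop)
      (ae_of_all _ fun z => (measurePreserving_add_right volume (δ * z)).map_eq)
  exact hmp.integrable_comp_of_integrable (hφ.comp_snd (gaussianReal 0 1))

lemma integral_gaussConv_eq {φ : ℝ → ℝ} (hφ : Integrable φ) {δ : ℝ} (hδ : 0 < δ) (A : Set ℝ) :
    ∫ x in A, gaussConv δ φ x = ∫ z, (∫ x in A, φ (x + δ * z)) ∂gaussianReal 0 1 := by
  simp only [gaussConv_eq_integral_standardGaussian hφ hδ]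
  refine (integral_integral_swap ?_).symm
  exact (integrable_prod_translate hφ δ).mono_measure
    (Measure.prod_mono le_rfl Measure.restrict_le_self)

lemma tendsto_setIntegral_truncSupp {φ ρ : ℝ → ℝ} (hφ : Integrable φ)
    (hsupp : ∀ x, x ∉ tsupport ρ → φ x = 0) :
    Tendsto (fun δ => ∫ x in truncSupp δ ρ, φ x) (𝓝[>] 0) (𝓝 (∫ x, φ x)) := by
  simp only [← integral_indicator (measurableSet_truncSupp _ ρ)]
  refine tendsto_integral_filter_of_dominated_convergence (fun x => ‖φ x‖)
    (Eventually.of_forall fun δ =>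
      hφ.aestronglyMeasurable.indicator (measurableSet_truncSupp δ ρ))
    (Eventually.of_forall fun δ => ae_of_all _ fun x => norm_indicator_le_norm_self φ x)
    hφ.norm (ae_of_all _ fun x => tendsto_const_nhds.congr' ?_)
  have hinv : ∀ᶠ δ : ℝ in 𝓝[>] 0, |x| ≤ δ⁻¹ :=
    tendsto_inv_nhdsGT_zero.eventually_ge_atTop |x|
  filter_upwards [hinv] with δ hδ
  by_cases hx : x ∈ tsupport ρ
  · rw [Set.indicator_of_mem]
    exact ⟨hx, by rw [one_div]; exact abs_le.1 hδ⟩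
  · rw [hsupp x hx, Set.indicator_of_notMem fun h => hx h.1]

/-- Mollifying and truncating does not lose mass in the limit. -/
lemma tendsto_setIntegral_gaussConv {φ ρ : ℝ → ℝ} (hφ : Integrable φ)
    (hsupp : ∀ x, x ∉ tsupport ρ → φ x = 0) :
    Tendsto (fun δ => ∫ x in truncSupp δ ρ, gaussConv δ φ x) (𝓝[>] 0) (𝓝 (∫ x, φ x)) := by
  have heq : (fun δ => ∫ z, (∫ x in truncSupp δ ρ, φ (x + δ * z)) ∂gaussianReal 0 1) =ᶠ[𝓝[>] 0]
      fun δ => ∫ x in truncSupp δ ρ, gaussConv δ φ x := by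
    filter_upwards [self_mem_nhdsWithin] with δ hδ
    exact (integral_gaussConv_eq hφ hδ _).symm
  refine Tendsto.congr' heq ?_
  have hconst : ∫ x, φ x = ∫ _z : ℝ, (∫ x, φ x) ∂gaussianReal 0 1 := by simp
  rw [hconst]
  refine tendsto_integral_filter_of_dominated_convergence (fun _ => ∫ x, ‖φ x‖) ?_ ?_
    (integrable_const _) (ae_of_all _ fun z => ?_)
  · refine Eventually.of_forall fun δ => ?_
    refine AEStronglyMeasurable.integral_prod_right'
      (f := fun p : ℝ × ℝ => φ (p.2 + δ * p.1)) ?_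
    exact (integrable_prod_translate hφ δ).aestronglyMeasurable.mono_measure
      (Measure.prod_mono le_rfl Measure.restrict_le_self)
  · refine Eventually.of_forall fun δ => ae_of_all _ fun z => ?_
    refine (norm_integral_le_integral_norm _).trans ?_
    refine (setIntegral_le_integral (hφ.comp_add_right (δ * z)).norm
      (ae_of_all _ fun x => norm_nonneg _)).trans_eq ?_
    exact integral_add_right_eq_self (fun x => ‖φ x‖) (δ * z)
  · have hz : Tendsto (fun δ : ℝ => δ * z) (𝓝[>] 0) (𝓝 0) := by
      have : Tendsto (fun δ : ℝ => δ * z) (𝓝 0) (𝓝 (0 * z)) := tendsto_id.mul_const z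
      rw [zero_mul] at this
      exact this.mono_left nhdsWithin_le_nhds
    have hdiff := (tendsto_integral_norm_translate_sub hφ).comp hz
    have hsub : Tendsto (fun δ => (∫ x in truncSupp δ ρ, φ (x + δ * z)) -
        ∫ x in truncSupp δ ρ, φ x) (𝓝[>] 0) (𝓝 0) := by
      refine squeeze_zero_norm (fun δ => ?_) hdiff
      have hi := hφ.comp_add_right (δ * z)
      rw [← integral_sub hi.integrableOn hφ.integrableOn]
      exact (norm_integral_le_integral_norm _).trans
        (setIntegral_le_integral (hi.sub hφ).norm (ae_of_all _ fun x => norm_nonneg _))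
    simpa using hsub.add (tendsto_setIntegral_truncSupp hφ hsupp)

/-- The energy of the mollified density is controlled by mollified quantities. -/
lemma integral_comp_mollified_le {H f1 f2 ρ : ℝ → ℝ}
    (hHconv : ConvexOn ℝ (Set.Ici 0) H) (hHcont : ContinuousOn H (Set.Ici 0)) (hH0 : H 0 = 0)
    (hdbl : ∀ x : ℝ, 0 ≤ x → ∀ α : ℝ, 0 ≤ α → H (α * x) ≤ f1 α * H x + f2 α * x)
    (hnn : ∀ x, 0 ≤ ρ x) (hint : Integrable ρ) (hHρ : Integrable fun x => H (ρ x))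
    {δ : ℝ} (hδ : 0 < δ) (hg : 0 < gaussMass δ ρ) (hf : 0 ≤ f1 (gaussMass δ ρ)⁻¹) :
    ∫ x, H (mollified δ ρ x) ≤
      f1 (gaussMass δ ρ)⁻¹ * (∫ x in truncSupp δ ρ, gaussConv δ (fun y => H (ρ y)) x) +
        f2 (gaussMass δ ρ)⁻¹ * gaussMass δ ρ := by
  have hS := isCompact_truncSupp δ ρ
  have hρc := continuous_gaussConv hint hδ
  have hHρc := continuous_gaussConv hHρ hδ
  have hρ0 := gaussConv_nonneg hnn hδ
  have hmol : (fun x => H (mollified δ ρ x)) =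
      (truncSupp δ ρ).indicator fun x => H ((gaussMass δ ρ)⁻¹ * gaussConv δ ρ x) := by
    ext x
    by_cases hx : x ∈ truncSupp δ ρ
    · simp [mollified, hx, div_eq_inv_mul]
    · simp [mollified, hx, hH0]
  have hcont : Continuous fun x => H ((gaussMass δ ρ)⁻¹ * gaussConv δ ρ x) :=
    hHcont.comp_continuous (by fun_prop) fun x => mul_nonneg (inv_nonneg.2 hg.le) (hρ0 x)
  have hi1 : IntegrableOn (fun x => f1 (gaussMass δ ρ)⁻¹ * gaussConv δ (fun y => H (ρ y)) x)
      (truncSupp δ ρ) := (Continuous.continuousOn (by fun_prop)).integrableOn_compact hS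
  have hi2 : IntegrableOn (fun x => f2 (gaussMass δ ρ)⁻¹ * gaussConv δ ρ x)
      (truncSupp δ ρ) := (Continuous.continuousOn (by fun_prop)).integrableOn_compact hS
  have hgm : ∫ x in truncSupp δ ρ, gaussConv δ ρ x = gaussMass δ ρ := rfl
  rw [hmol, integral_indicator hS.measurableSet]
  calc ∫ x in truncSupp δ ρ, H ((gaussMass δ ρ)⁻¹ * gaussConv δ ρ x)
      ≤ ∫ x in truncSupp δ ρ, (f1 (gaussMass δ ρ)⁻¹ * gaussConv δ (fun y => H (ρ y)) x +
          f2 (gaussMass δ ρ)⁻¹ * gaussConv δ ρ x) := by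
        refine integral_mono (hcont.continuousOn.integrableOn_compact hS) (hi1.add hi2)
          fun x => ?_
        refine (hdbl _ (hρ0 x) _ (inv_nonneg.2 hg.le)).trans ?_
        gcongr
        exact hHconv.map_gaussConv_le hHcont hnn hint hHρ hδ x
    _ = _ := by rw [integral_add hi1 hi2, integral_const_mul, integral_const_mul, hgm]

/-- Under the doubling-type bound `H(αx) ≤ f₁(α)H(x) + f₂(α)x`, for a
probability density `ρ` with `H ∘ ρ ∈ L¹`, the masses `g_δ` tend to `1` as `δ → 0⁺`
and `limsup_{δ→0} ∫ H(ρ_δ) ≤ ∫ H(ρ)` (rendered via an `ε`-`δ₀` statement). -/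
theorem mollified_energy_limsup (H f1 f2 ρ : ℝ → ℝ)
    (hHconv : ConvexOn ℝ (Set.Ici 0) H)
    (hHcont : ContinuousOn H (Set.Ici 0))
    (hH0 : H 0 = 0)
    (hf1c : Continuous f1) (hf2c : Continuous f2)
    (hf11 : f1 1 = 1) (hf21 : f2 1 = 0)
    (hdbl : ∀ x : ℝ, 0 ≤ x → ∀ α : ℝ, 0 ≤ α → H (α * x) ≤ f1 α * H x + f2 α * x)
    (hmeas : Measurable ρ) (hnn : ∀ x, 0 ≤ ρ x) (hint : Integrable ρ)
    (hmass : ∫ x, ρ x = 1) (hHρ : Integrable (fun x => H (ρ x))) :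
    Filter.Tendsto (fun δ => gaussMass δ ρ) (nhdsWithin 0 (Set.Ioi 0)) (nhds 1) ∧
    ∀ ε : ℝ, 0 < ε → ∃ δ₀ : ℝ, 0 < δ₀ ∧ ∀ δ : ℝ, 0 < δ → δ < δ₀ →
      (∫ x : ℝ, H (mollified δ ρ x)) ≤ (∫ x : ℝ, H (ρ x)) + ε := by
  have hρ0 : ∀ x, x ∉ tsupport ρ → ρ x = 0 := fun x hx => image_eq_zero_of_notMem_tsupport hx
  have hmassLim : Tendsto (fun δ => gaussMass δ ρ) (𝓝[>] 0) (𝓝 1) :=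
    hmass ▸ tendsto_setIntegral_gaussConv hint hρ0
  refine ⟨hmassLim, fun ε hε => ?_⟩
  have henergy := tendsto_setIntegral_gaussConv hHρ fun x hx => by rw [hρ0 x hx, hH0]
  have hinv : Tendsto (fun δ => (gaussMass δ ρ)⁻¹) (𝓝[>] 0) (𝓝 1) := by
    simpa using hmassLim.inv₀ one_ne_zero
  have hf1lim : Tendsto (fun δ => f1 (gaussMass δ ρ)⁻¹) (𝓝[>] 0) (𝓝 1) :=
    hf11 ▸ (hf1c.tendsto 1).comp hinv
  have hf2lim : Tendsto (fun δ => f2 (gaussMass δ ρ)⁻¹) (𝓝[>] 0) (𝓝 0) := by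
    exact (hf2c.tendsto' 1 0 hf21).comp hinv
  have hbound := (hf1lim.mul henergy).add (hf2lim.mul hmassLim)
  rw [one_mul, zero_mul, add_zero] at hbound
  have hev : ∀ᶠ δ in 𝓝[>] (0 : ℝ),
      (∫ x : ℝ, H (mollified δ ρ x)) ≤ (∫ x : ℝ, H (ρ x)) + ε := by
    filter_upwards [self_mem_nhdsWithin, hmassLim.eventually_const_lt one_pos,
      hf1lim.eventually_const_lt one_pos,
      hbound.eventually_lt_const (lt_add_of_pos_right _ hε)] with δ hδ hg hf hlt
    exact (integral_comp_mollified_le hHconv hHcont hH0 hdbl hnn hint hHρ hδ hg hf.le).trans hlt.le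
  obtain ⟨δ₀, hδ₀, hsub⟩ := mem_nhdsGT_iff_exists_Ioo_subset.1 hev
  exact ⟨δ₀, hδ₀, fun δ h0 h1 => hsub ⟨h0, h1⟩⟩
end

section
/- Let ℓ > 0, N ≥ 3, and let x ∈ ℝ^N with −ℓ = x_1 < x_2 < ⋯ < x_N = ℓ. Let E_N^ℓ be the discrete heat energy with no-flux conventions. If v ∈ ℝ^N is a subgradient of E_N^ℓ at x (i.e., E_N^ℓ(y) ≥ E_N^ℓ(x) + ⟨v, y−x⟩ for all y ∈ ℝ^N), then N|v_i| ≥ |1/Δx_i − 1/Δx_{i+1}| for every i ∈ {2,…,N−1}; consequently N² Σ_{i=1}^N v_i² ≥ Σ_{i=2}^{N−1} (1/Δx_i − 1/Δx_{i+1})². -/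
open MeasureTheory

/-- The domain `D_ℓ` of the no-flux discretisation on `[-ℓ,ℓ]` (particles indexed
`1,…,N`): `-2ℓ - x_2 < x_1 < x_2 < ⋯ < x_N < 2ℓ - x_{N-1}`. -/
def noFluxDomain (N : ℕ) (l : ℝ) : Set (ℕ → ℝ) :=
  {x | (∀ i, 1 ≤ i → i < N → x i < x (i + 1)) ∧
       -(2 * l) - x 2 < x 1 ∧ x N < 2 * l - x (N - 1)}

/-- Ball radius with no-flux conventions on `[-ℓ,ℓ]`: `r_i = min(Δx_i, Δx_{i+1})` for
`i = 2,…,N-1`; `r_1 = Δx_2` if `x_1 > -ℓ` and `min(Δx_2, x_1 + 2ℓ + x_2)` otherwise;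
`r_N = Δx_N` if `x_N < ℓ` and `min(Δx_N, 2ℓ - x_{N-1} - x_N)` otherwise. -/
noncomputable def noFluxR (N : ℕ) (l : ℝ) (x : ℕ → ℝ) (i : ℕ) : ℝ :=
  if i = 1 then
    (if -l < x 1 then x 2 - x 1 else min (x 2 - x 1) (x 1 + 2 * l + x 2))
  else if i = N then
    (if x N < l then x N - x (N - 1) else min (x N - x (N - 1)) (2 * l - x (N - 1) - x N))
  else min (x i - x (i - 1)) (x (i + 1) - x i)

/-- The discrete heat energy with no-flux conventions,
`E_N^ℓ(x) = -log N - (1/N) ∑_{i=1}^N log r_i`. -/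
noncomputable def noFluxEnergy (N : ℕ) (l : ℝ) (x : ℕ → ℝ) : ℝ :=
  -Real.log N - (1 / N : ℝ) * ∑ i ∈ Finset.Icc 1 N, Real.log (noFluxR N l x i)

open Filter Topology

lemma noFluxR_first {N : ℕ} {l : ℝ} {x : ℕ → ℝ} (hx1 : x 1 = -l) :
    noFluxR N l x 1 = x 2 - x 1 := by
  rw [noFluxR, if_pos rfl, if_neg (by rw [hx1]; exact lt_irrefl _)]
  exact min_eq_left (by rw [hx1]; linarith)

lemma noFluxR_last {N : ℕ} (hN : 3 ≤ N) {l : ℝ} {x : ℕ → ℝ} (hxN : x N = l) :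
    noFluxR N l x N = x N - x (N - 1) := by
  rw [noFluxR, if_neg (by omega), if_pos rfl, if_neg (by rw [hxN]; exact lt_irrefl _)]
  exact min_eq_left (by rw [hxN]; linarith)

lemma noFluxR_interior {N : ℕ} {l : ℝ} {x : ℕ → ℝ} {i : ℕ} (h1 : i ≠ 1) (hN : i ≠ N) :
    noFluxR N l x i = min (x i - x (i - 1)) (x (i + 1) - x i) := by
  rw [noFluxR, if_neg h1, if_neg hN]

lemma noFluxR_pos {N : ℕ} (hN : 3 ≤ N) {l : ℝ} {x : ℕ → ℝ}
    (hx : ∀ i, 1 ≤ i → i < N → x i < x (i + 1)) (hx1 : x 1 = -l) (hxN : x N = l)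
    {j : ℕ} (hj1 : 1 ≤ j) (hjN : j ≤ N) : 0 < noFluxR N l x j := by
  have hgap : ∀ k, 2 ≤ k → k ≤ N → 0 < x k - x (k - 1) := fun k h2 hk => by
    have := hx (k - 1) (by omega) (by omega)
    rw [Nat.sub_add_cancel (by omega)] at this
    linarith
  rcases eq_or_ne j 1 with rfl | h1
  · rw [noFluxR_first hx1]
    exact hgap 2 le_rfl (by omega)
  rcases eq_or_ne j N with rfl | hjN'
  · rw [noFluxR_last hN hxN]
    exact hgap j (by omega) le_rfl
  rw [noFluxR_interior h1 hjN']
  exact lt_min (hgap j (by omega) hjN) (hgap (j + 1) (by omega) (by omega))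

lemma min_mul_min_one_div_le {a a' c : ℝ} (ha : 0 < a) (hc : 0 < c) (ha' : 0 < a') :
    min c a * min 1 (a' / a) ≤ min c a' := by
  refine le_min ?_ ?_
  · calc min c a * min 1 (a' / a) ≤ c * 1 := by gcongr <;> exact min_le_left _ _
      _ = c := mul_one c
  · calc min c a * min 1 (a' / a) ≤ a * (a' / a) := by gcongr <;> exact min_le_right _ _
      _ = a' := by field_simp

lemma mul_min_one_div_le {a a' : ℝ} (ha : 0 < a) : a * min 1 (a' / a) ≤ a' := by
  calc a * min 1 (a' / a) ≤ a * (a' / a) := by gcongr; exact min_le_right _ _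
    _ = a' := by field_simp

/-- Moving one interior particle by `t` changes its radius to `min (a + t) (b - t)` and shrinks the
neighbouring radii by at most the ratios of the new gaps to the old ones. -/
lemma sum_log_noFluxR_update_ge {N : ℕ} (hN : 3 ≤ N) {l : ℝ} {x : ℕ → ℝ}
    (hx : ∀ i, 1 ≤ i → i < N → x i < x (i + 1)) (hx1 : x 1 = -l) (hxN : x N = l)
    {i : ℕ} (hi2 : 2 ≤ i) (hiN : i ≤ N - 1) {t a b : ℝ}
    (ha : a = x i - x (i - 1)) (hb : b = x (i + 1) - x i) (hat : 0 < a + t) (hbt : 0 < b - t) :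
    (∑ j ∈ Finset.Icc 1 N, Real.log (noFluxR N l x j))
      + Real.log (min 1 ((a + t) / a)) + (Real.log (min (a + t) (b - t)) - Real.log (min a b))
      + Real.log (min 1 ((b - t) / b)) ≤
    ∑ j ∈ Finset.Icc 1 N, Real.log (noFluxR N l (Function.update x i (x i + t)) j) := by
  set y := Function.update x i (x i + t) with hy
  have yi : y i = x i + t := by simp [hy]
  have yo : ∀ k, k ≠ i → y k = x k := fun k hk => by simp [hy, hk]
  have hy1 : y 1 = -l := by rw [yo 1 (by omega), hx1]
  have hyN : y N = l := by rw [yo N (by omega), hxN]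
  have ha0 : 0 < a := by
    have := hx (i - 1) (by omega) (by omega)
    rw [Nat.sub_add_cancel (by omega)] at this
    linarith
  have hb0 : 0 < b := by linarith [hx i (by omega) (by omega)]
  have ratio : ∀ {p q r s : ℝ}, 0 < p → 0 < r → 0 < s → p * min 1 (r / s) ≤ q →
      Real.log p + Real.log (min 1 (r / s)) ≤ Real.log q := fun {p q r s} hp hr hs h => by
    have hm : 0 < min 1 (r / s) := lt_min one_pos (div_pos hr hs)
    rw [← Real.log_mul hp.ne' hm.ne']
    exact Real.log_le_log (mul_pos hp hm) h
  have left : Real.log (noFluxR N l x (i - 1)) + Real.log (min 1 ((a + t) / a)) ≤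
      Real.log (noFluxR N l y (i - 1)) := by
    refine ratio (noFluxR_pos hN hx hx1 hxN (by omega) (by omega)) hat ha0 ?_
    rcases eq_or_ne i 2 with rfl | h2
    · rw [show 2 - 1 = 1 from rfl, noFluxR_first hx1, noFluxR_first hy1, yi, yo 1 (by omega),
        show x 2 + t - x 1 = a + t by rw [ha]; ring, show x 2 - x 1 = a from ha.symm]
      exact mul_min_one_div_le ha0
    · have hc := hx (i - 1 - 1) (by omega) (by omega)
      rw [Nat.sub_add_cancel (by omega)] at hc
      rw [noFluxR_interior (by omega) (by omega), noFluxR_interior (by omega) (by omega),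
        Nat.sub_add_cancel (by omega), yi, yo (i - 1) (by omega), yo (i - 1 - 1) (by omega),
        show x i + t - x (i - 1) = a + t by rw [ha]; ring, ← ha]
      exact min_mul_min_one_div_le ha0 (by linarith) hat
  have right : Real.log (noFluxR N l x (i + 1)) + Real.log (min 1 ((b - t) / b)) ≤
      Real.log (noFluxR N l y (i + 1)) := by
    refine ratio (noFluxR_pos hN hx hx1 hxN (by omega) (by omega)) hbt hb0 ?_
    rcases eq_or_ne (i + 1) N with rfl | h2
    · rw [noFluxR_last hN hxN, noFluxR_last hN hyN, Nat.add_sub_cancel, yi, yo (i + 1) (by omega),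
        show x (i + 1) - (x i + t) = b - t by rw [hb]; ring, ← hb]
      exact mul_min_one_div_le hb0
    · have hc := hx (i + 1) (by omega) (by omega)
      rw [noFluxR_interior (by omega) (by omega), noFluxR_interior (by omega) (by omega),
        Nat.add_sub_cancel, yi, yo (i + 1) (by omega), yo (i + 1 + 1) (by omega),
        show x (i + 1) - (x i + t) = b - t by rw [hb]; ring, ← hb, min_comm b, min_comm (b - t)]
      exact min_mul_min_one_div_le hb0 (by linarith) hbt
  have mid_x : noFluxR N l x i = min a b := by
    rw [noFluxR_interior (by omega) (by omega), ha, hb]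
  have mid_y : noFluxR N l y i = min (a + t) (b - t) := by
    rw [noFluxR_interior (by omega) (by omega), yi, yo (i - 1) (by omega), yo (i + 1) (by omega),
      ha, hb]
    congr 1 <;> ring
  have far : ∀ j, 1 ≤ j → j ≤ N → j ≠ i - 1 → j ≠ i → j ≠ i + 1 →
      noFluxR N l y j = noFluxR N l x j := fun j h1 hjN hl' hm hr => by
    rcases eq_or_ne j 1 with rfl | hj1
    · rw [noFluxR_first hx1, noFluxR_first hy1, yo 1 hm, yo 2 (by omega)]
    rcases eq_or_ne j N with rfl | hjN'
    · rw [noFluxR_last hN hxN, noFluxR_last hN hyN, yo j hm, yo (j - 1) (by omega)]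
    rw [noFluxR_interior hj1 hjN', noFluxR_interior hj1 hjN', yo j hm, yo (j - 1) (by omega),
      yo (j + 1) (by omega)]
  calc _ = ∑ j ∈ Finset.Icc 1 N, (Real.log (noFluxR N l x j)
        + (if j = i - 1 then Real.log (min 1 ((a + t) / a)) else 0)
        + (if j = i then Real.log (min (a + t) (b - t)) - Real.log (min a b) else 0)
        + (if j = i + 1 then Real.log (min 1 ((b - t) / b)) else 0)) := by
        simp only [Finset.sum_add_distrib, Finset.sum_ite_eq', Finset.mem_Icc]
        rw [if_pos (by omega), if_pos (by omega), if_pos (by omega)]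
    _ ≤ _ := by
        refine Finset.sum_le_sum fun j hj => ?_
        rw [Finset.mem_Icc] at hj
        rcases eq_or_ne j i with rfl | hm
        · rw [if_neg (by omega), if_pos rfl, if_neg (by omega), mid_x, mid_y]
          linarith
        rcases eq_or_ne j (i - 1) with rfl | hl'
        · rw [if_pos rfl, if_neg hm, if_neg (by omega)]
          linarith
        rcases eq_or_ne j (i + 1) with rfl | hr
        · rw [if_neg hl', if_neg hm, if_pos rfl]
          linarith
        rw [if_neg hl', if_neg hm, if_neg hr, far j hj.1 hj.2 hl' hm hr]
        linarith

lemma subgradient_noFlux_mul_le {N : ℕ} (hN : 3 ≤ N) {l : ℝ} {x : ℕ → ℝ}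
    (hx : ∀ i, 1 ≤ i → i < N → x i < x (i + 1)) (hx1 : x 1 = -l) (hxN : x N = l)
    {v : ℕ → ℝ}
    (hv : ∀ y ∈ noFluxDomain N l,
      noFluxEnergy N l y ≥ noFluxEnergy N l x + ∑ i ∈ Finset.Icc 1 N, v i * (y i - x i))
    {i : ℕ} (hi2 : 2 ≤ i) (hiN : i ≤ N - 1) {t a b : ℝ}
    (ha : a = x i - x (i - 1)) (hb : b = x (i + 1) - x i) (hat : 0 < a + t) (hbt : 0 < b - t) :
    N * v i * t + Real.log (min 1 ((a + t) / a))
      + (Real.log (min (a + t) (b - t)) - Real.log (min a b))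
      + Real.log (min 1 ((b - t) / b)) ≤ 0 := by
  have hsum := sum_log_noFluxR_update_ge hN hx hx1 hxN hi2 hiN ha hb hat hbt
  set y := Function.update x i (x i + t) with hy
  have yi : y i = x i + t := by simp [hy]
  have yo : ∀ k, k ≠ i → y k = x k := fun k hk => by simp [hy, hk]
  have hord : ∀ k, 1 ≤ k → k < N → y k < y (k + 1) := fun k hk1 hkN => by
    rcases eq_or_ne k i with rfl | hk
    · rw [yi, yo (k + 1) (by omega)]
      linarith
    rcases eq_or_ne (k + 1) i with rfl | hk'
    · rw [yi, yo k hk]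
      rw [Nat.add_sub_cancel] at ha
      linarith
    rw [yo k hk, yo (k + 1) hk']
    exact hx k hk1 hkN
  have hy1 : y 1 = -l := by rw [yo 1 (by omega), hx1]
  have hyN : y N = l := by rw [yo N (by omega), hxN]
  have hmem : y ∈ noFluxDomain N l := by
    refine ⟨hord, ?_, ?_⟩
    · have : y 1 < y 2 := hord 1 le_rfl (by omega)
      linarith
    · have := hord (N - 1) (by omega) (by omega)
      rw [Nat.sub_add_cancel (by omega)] at this
      linarith
  have hpair : ∑ j ∈ Finset.Icc 1 N, v j * (y j - x j) = v i * t := by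
    rw [Finset.sum_eq_single i]
    · rw [yi]; ring
    · intro j _ hj
      rw [yo j hj]; ring
    · intro h
      exact absurd (Finset.mem_Icc.2 ⟨by omega, by omega⟩) h
  have hE := hv y hmem
  rw [hpair, noFluxEnergy, noFluxEnergy] at hE
  have hN0 : (0 : ℝ) < N := by exact_mod_cast (by omega : 0 < N)
  set S := ∑ j ∈ Finset.Icc 1 N, Real.log (noFluxR N l x j)
  set T := ∑ j ∈ Finset.Icc 1 N, Real.log (noFluxR N l y j)
  have h : N * (v i * t) ≤ N * (1 / N * S - 1 / N * T) :=
    mul_le_mul_of_nonneg_left (by linarith) hN0.le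
  have h' : N * (1 / N * S - 1 / N * T) = S - T := by field_simp
  linarith

/-- A first-order consequence of a logarithmic inequality holding for small positive `t`. -/
lemma one_div_sub_one_div_le_of_log {a b w : ℝ} (ha : 0 < a) (hab : a < b)
    (h : ∀ t, 0 < t → t < (b - a) / 2 →
      Real.log ((a + t) / a) + Real.log ((b - t) / b) ≤ w * t) :
    1 / a - 1 / b ≤ w := by
  have hb : 0 < b := ha.trans hab
  have hlim : Tendsto (fun t : ℝ => 1 / (a + t) - 1 / (b - t)) (𝓝[>] 0) (𝓝 (1 / a - 1 / b)) := by
    have hc : ContinuousAt (fun t : ℝ => 1 / (a + t) - 1 / (b - t)) 0 := by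
      refine ContinuousAt.sub (ContinuousAt.div (by fun_prop) (by fun_prop) ?_)
        (ContinuousAt.div (by fun_prop) (by fun_prop) ?_)
      · simpa using ha.ne'
      · simpa using hb.ne'
    simpa using hc.tendsto.mono_left nhdsWithin_le_nhds
  refine le_of_tendsto hlim ?_
  filter_upwards [Ioo_mem_nhdsGT (show (0 : ℝ) < (b - a) / 2 by linarith)] with t ht
  obtain ⟨ht0, ht1⟩ := ht
  have hat : 0 < a + t := by linarith
  have hbt : 0 < b - t := by linarith
  have h1 := Real.one_sub_inv_le_log_of_pos (div_pos hat ha)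
  have h2 := Real.one_sub_inv_le_log_of_pos (div_pos hbt hb)
  have e1 : 1 - ((a + t) / a)⁻¹ = t * (1 / (a + t)) := by field_simp; ring
  have e2 : 1 - ((b - t) / b)⁻¹ = -(t * (1 / (b - t))) := by field_simp; ring
  have h3 := h t ht0 ht1
  refine le_of_mul_le_mul_left ?_ ht0
  rw [mul_sub]
  linarith

lemma abs_subgradient_noFlux_ge {N : ℕ} (hN : 3 ≤ N) {l : ℝ} {x : ℕ → ℝ}
    (hx : ∀ i, 1 ≤ i → i < N → x i < x (i + 1)) (hx1 : x 1 = -l) (hxN : x N = l)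
    {v : ℕ → ℝ}
    (hv : ∀ y ∈ noFluxDomain N l,
      noFluxEnergy N l y ≥ noFluxEnergy N l x + ∑ i ∈ Finset.Icc 1 N, v i * (y i - x i))
    {i : ℕ} (hi2 : 2 ≤ i) (hiN : i ≤ N - 1) :
    |1 / (x i - x (i - 1)) - 1 / (x (i + 1) - x i)| ≤ N * |v i| := by
  obtain ⟨a, ha⟩ : ∃ a, a = x i - x (i - 1) := ⟨_, rfl⟩
  obtain ⟨b, hb⟩ : ∃ b, b = x (i + 1) - x i := ⟨_, rfl⟩
  have ha0 : 0 < a := by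
    have := hx (i - 1) (by omega) (by omega)
    rw [Nat.sub_add_cancel (by omega)] at this
    linarith
  have hb0 : 0 < b := by linarith [hx i (by omega) (by omega)]
  rw [← ha, ← hb, ← Nat.abs_cast N, ← abs_mul]
  rcases lt_trichotomy a b with hab | hab | hab
  · have key : 1 / a - 1 / b ≤ -(N * v i) := by
      refine one_div_sub_one_div_le_of_log ha0 hab fun t ht0 ht1 => ?_
      have h := subgradient_noFlux_mul_le hN hx hx1 hxN hv hi2 hiN ha hb
        (t := t) (by linarith) (by linarith)
      rw [min_eq_left ((one_le_div ha0).2 (by linarith)),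
        min_eq_right ((div_le_one hb0).2 (by linarith)), min_eq_left (by linarith),
        min_eq_left hab.le, Real.log_one] at h
      rw [Real.log_div (by linarith) ha0.ne']
      linarith
    rw [abs_of_pos (sub_pos.2 (one_div_lt_one_div_of_lt ha0 hab))]
    exact key.trans (neg_le_abs _)
  · rw [hab, sub_self, abs_zero]
    exact abs_nonneg _
  · have key : 1 / b - 1 / a ≤ N * v i := by
      refine one_div_sub_one_div_le_of_log hb0 hab fun t ht0 ht1 => ?_
      have h := subgradient_noFlux_mul_le hN hx hx1 hxN hv hi2 hiN ha hb
        (t := -t) (by linarith) (by linarith)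
      rw [sub_neg_eq_add, ← sub_eq_add_neg, min_eq_right ((div_le_one ha0).2 (by linarith)),
        min_eq_left ((one_le_div hb0).2 (by linarith)), min_eq_right (by linarith),
        min_eq_right hab.le, Real.log_one] at h
      rw [Real.log_div (by linarith) hb0.ne']
      linarith
    rw [abs_sub_comm, abs_of_pos (sub_pos.2 (one_div_lt_one_div_of_lt hb0 hab))]
    exact key.trans (le_abs_self _)

/-- If `v` is a subgradient of the no-flux discrete heat energy at a
configuration `-ℓ = x_1 < ⋯ < x_N = ℓ`, then `N|v_i| ≥ |1/Δx_i - 1/Δx_{i+1}|` for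
`i = 2,…,N-1`, and consequently `N² ∑ v_i² ≥ ∑_{i=2}^{N-1} (1/Δx_i - 1/Δx_{i+1})²`. -/
theorem noflux_subgradient_lower_bound (l : ℝ) (hl : 0 < l) (N : ℕ) (hN : 3 ≤ N)
    (x : ℕ → ℝ) (hx : ∀ i, 1 ≤ i → i < N → x i < x (i + 1))
    (hx1 : x 1 = -l) (hxN : x N = l)
    (v : ℕ → ℝ)
    (hv : ∀ y ∈ noFluxDomain N l,
      noFluxEnergy N l y ≥ noFluxEnergy N l x +
        ∑ i ∈ Finset.Icc 1 N, v i * (y i - x i)) :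
    (∀ i, 2 ≤ i → i ≤ N - 1 →
      (N : ℝ) * |v i| ≥ |1 / (x i - x (i - 1)) - 1 / (x (i + 1) - x i)|) ∧
    (N : ℝ) ^ 2 * ∑ i ∈ Finset.Icc 1 N, v i ^ 2 ≥
      ∑ i ∈ Finset.Icc 2 (N - 1), (1 / (x i - x (i - 1)) - 1 / (x (i + 1) - x i)) ^ 2 := by
  have hbound : ∀ i, 2 ≤ i → i ≤ N - 1 →
      (N : ℝ) * |v i| ≥ |1 / (x i - x (i - 1)) - 1 / (x (i + 1) - x i)| :=
    fun i hi2 hiN => abs_subgradient_noFlux_ge hN hx hx1 hxN hv hi2 hiN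
  refine ⟨hbound, ?_⟩
  rw [ge_iff_le, Finset.mul_sum]
  calc _ ≤ ∑ i ∈ Finset.Icc 2 (N - 1), (N : ℝ) ^ 2 * v i ^ 2 := by
        refine Finset.sum_le_sum fun i hi => ?_
        rw [Finset.mem_Icc] at hi
        rw [← mul_pow, sq_le_sq, abs_mul, Nat.abs_cast]
        exact hbound i hi.1 hi.2
    _ ≤ _ := Finset.sum_le_sum_of_subset_of_nonneg
        (Finset.Icc_subset_Icc (by omega) (by omega)) fun i _ _ => by positivity
end

section
/- Let N ≥ 3, a_2 > 0, and let x_1 < x_2 < ⋯ < x_N be real numbers with Δx_i ≤ a_2/N for every i ∈ {2,…,N}. Then the total gap between the discretisation intervals satisfies Σ_{i=1}^{N−1} (Δx_{i+1} − r_i/2 − r_{i+1}/2) ≤ 2a_2/N + a_2 · max_{i∈{2,…,N−1}} |Δx_{i+1}/Δx_i − 1|. -/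
/-- If `Δx_i ≤ a₂/N` for all `i`, the total gap between the
discretisation intervals satisfies
`∑_{i=1}^{N-1} (Δx_{i+1} - r_i/2 - r_{i+1}/2)
  ≤ 2a₂/N + a₂ · max_{2 ≤ i ≤ N-1} |Δx_{i+1}/Δx_i - 1|`. -/
theorem total_gap_bound (N : ℕ) (hN : 3 ≤ N) (a2 : ℝ) (ha2 : 0 < a2)
    (x : ℕ → ℝ) (hx : ∀ i, 1 ≤ i → i < N → x i < x (i + 1))
    (hub : ∀ i, 2 ≤ i → i ≤ N → x i - x (i - 1) ≤ a2 / N) :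
    ∑ i ∈ Finset.Icc 1 (N - 1),
        (x (i + 1) - x i - rGap N x i / 2 - rGap N x (i + 1) / 2)
      ≤ 2 * a2 / N + a2 *
        (Finset.Icc 2 (N - 1)).sup' (Finset.nonempty_Icc.mpr (by omega))
          (fun i => |(x (i + 1) - x i) / (x i - x (i - 1)) - 1|) := by
  set M := (Finset.Icc 2 (N - 1)).sup' (Finset.nonempty_Icc.mpr (by omega))
    (fun i => |(x (i + 1) - x i) / (x i - x (i - 1)) - 1|)
  have hle : ∀ i, 2 ≤ i → i ≤ N - 1 →
      |(x (i + 1) - x i) / (x i - x (i - 1)) - 1| ≤ M := fun i h1 h2 =>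
    Finset.le_sup' (fun i => |(x (i + 1) - x i) / (x i - x (i - 1)) - 1|)
      (Finset.mem_Icc.mpr ⟨h1, h2⟩)
  have hM0 : 0 ≤ M := (abs_nonneg _).trans (hle 2 le_rfl (by omega))
  have hNpos : (0 : ℝ) < N := by exact_mod_cast (by omega : 0 < N)
  have hB0 : 0 ≤ M * (a2 / N) := by positivity
  have hdiff : ∀ i, 2 ≤ i → i ≤ N - 1 →
      |(x (i + 1) - x i) - (x i - x (i - 1))| ≤ M * (a2 / N) := by
    intro i h1 h2
    have hpos : 0 < x i - x (i - 1) := by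
      have := hx (i - 1) (by omega) (by omega)
      rw [Nat.sub_add_cancel (by omega)] at this
      linarith
    calc |(x (i + 1) - x i) - (x i - x (i - 1))|
        = |(x (i + 1) - x i) / (x i - x (i - 1)) - 1| * (x i - x (i - 1)) := by
          rw [← abs_of_pos hpos, ← abs_mul, abs_of_pos hpos, sub_mul,
            div_mul_cancel₀ _ hpos.ne', one_mul]
      _ ≤ M * (a2 / N) :=
          mul_le_mul (hle i h1 h2) (hub i h1 (by omega)) hpos.le hM0
  have hleft : ∀ i, 1 ≤ i → i ≤ N - 1 →
      x (i + 1) - x i - rGap N x i ≤ M * (a2 / N) := by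
    intro i h1 h2
    rcases h1.eq_or_lt with rfl | h1
    · simpa [rGap] using hB0
    · have h := abs_le.mp (hdiff i h1 h2)
      rw [rGap, if_neg (by omega), if_neg (by omega), sub_le_comm]
      exact le_min (by linarith) (by linarith)
  have hright : ∀ i, 1 ≤ i → i ≤ N - 1 →
      x (i + 1) - x i - rGap N x (i + 1) ≤ M * (a2 / N) := by
    intro i h1 h2
    rw [rGap, if_neg (by omega)]
    split_ifs with h
    · subst h
      simpa using hB0
    · have h := abs_le.mp (hdiff (i + 1) (by omega) (by omega))
      rw [Nat.add_sub_cancel] at h ⊢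
      rw [sub_le_comm]
      exact le_min (by linarith) (by linarith)
  have hsum : ∑ i ∈ Finset.Icc 1 (N - 1),
      (x (i + 1) - x i - rGap N x i / 2 - rGap N x (i + 1) / 2)
        ≤ (Finset.Icc 1 (N - 1)).card • (M * (a2 / N)) := by
    refine Finset.sum_le_card_nsmul _ _ _ fun i hi => ?_
    obtain ⟨h1, h2⟩ := Finset.mem_Icc.mp hi
    linarith [hleft i h1 h2, hright i h1 h2]
  have hcard : ((Finset.Icc 1 (N - 1)).card : ℝ) ≤ N := by
    rw [Nat.card_Icc]
    exact_mod_cast (by omega : N - 1 + 1 - 1 ≤ N)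
  have hextra : 0 ≤ 2 * a2 / N := by positivity
  calc _ ≤ ((Finset.Icc 1 (N - 1)).card : ℝ) * (M * (a2 / N)) := by
        rwa [nsmul_eq_mul] at hsum
    _ ≤ N * (M * (a2 / N)) := mul_le_mul_of_nonneg_right hcard hB0
    _ = a2 * M := by field_simp
    _ ≤ 2 * a2 / N + a2 * M := by linarith
end

section
/- Let N ≥ 2, 0 < a_1 ≤ a_2, and let x_1 < x_2 < ⋯ < x_N be real numbers with a_1/N ≤ Δx_i ≤ a_2/N for every i ∈ {2,…,N}; set, by convention, Δx_1 = Δx_2. Define ν_N : [x_1, x_N] → (0,∞) piecewise by ν_N(x) = (1/(N Δx_{i+1}²)) ( (x − x_i)/√Δx_{i+1} + (x_{i+1} − x)/√Δx_i )² for x ∈ [x_i, x_{i+1}], i = 1,…,N−1. Then for every bounded Lipschitz function φ : ℝ → ℝ with Lipschitz constant L and sup-norm ‖φ‖_∞: | ∫_{x_1}^{x_N} φ(x) ν_N(x) dx − (1/N) Σ_{i=1}^N φ(x_i) | ≤ (2 a_2 ‖φ‖_∞ / a_1) · max_{i∈{2,…,N}} |1 − √(Δx_i/Δx_{i−1})|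 + (L a_2 + ‖φ‖_∞)/N. -/
open MeasureTheory

/-- Inter-particle distance `Δx_i = x_i - x_{i-1}` with the convention `Δx_1 = Δx_2`
(particles indexed `1,…,N`). -/
noncomputable def Dx (x : ℕ → ℝ) (i : ℕ) : ℝ :=
  if i = 1 then x 2 - x 1 else x i - x (i - 1)

/-- The interpolated density on a cell of length `d`, next to a cell of length `e`, is the
constant `1 / (N d)` times the square of a convex combination of `1` and `√(d / e)`. -/
lemma density_eq_convex_combination_sq {d e : ℝ} (hd : 0 < d) (he : 0 < e) (N s : ℝ) :
    1 / (N * d ^ 2) * (s / √d + (d - s) / √e) ^ 2 =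
      1 / (N * d) * (s / d + (1 - s / d) * √(d / e)) ^ 2 := by
  have hu : 0 < √d := Real.sqrt_pos.mpr hd
  have hv : 0 < √e := Real.sqrt_pos.mpr he
  have hsq : √d ^ 2 = d := Real.sq_sqrt hd.le
  rw [Real.sqrt_div hd.le]
  have key : s / √d + (d - s) / √e = √d * (s / d + (1 - s / d) * (√d / √e)) := by
    generalize √d = u at *
    subst hsq
    field_simp
  rw [key, mul_pow, hsq]
  rcases eq_or_ne N 0 with rfl | hN
  · simp
  · field_simp

lemma abs_convex_combination_sq_sub_one_le {θ r K : ℝ} (h0 : 0 ≤ θ) (h1 : θ ≤ 1) (hr : 0 ≤ r)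
    (hK : 1 + r ≤ K) : |(θ + (1 - θ) * r) ^ 2 - 1| ≤ K * |1 - r| := by
  have hfac : (θ + (1 - θ) * r) ^ 2 - 1 = -((1 - θ) * (1 + θ + (1 - θ) * r) * (1 - r)) := by ring
  have hnn : 0 ≤ (1 - θ) * (1 + θ + (1 - θ) * r) := by
    have : 0 ≤ 1 - θ := by linarith
    positivity
  rw [hfac, abs_neg, abs_mul, abs_of_nonneg hnn]
  gcongr
  nlinarith [mul_nonneg (mul_nonneg h0 hr) (by linarith : 0 ≤ 2 - θ), sq_nonneg θ]

/-- On a single cell, the integral of `φ` against the interpolated density is close to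
`φ p / N`, where `p` is the left endpoint. -/
lemma abs_cell_integral_sub_le {N p q e K L C : ℝ} (hN : 0 < N) (hpq : p < q) (he : 0 < e)
    (hK : 1 + √((q - p) / e) ≤ K) {φ : ℝ → ℝ} (hL : 0 ≤ L)
    (hLip : ∀ a b, |φ a - φ b| ≤ L * |a - b|) (hbd : ∀ a, |φ a| ≤ C) :
    |(∫ t in p..q, φ t * (1 / (N * (q - p) ^ 2) *
        ((t - p) / √(q - p) + (q - t) / √e) ^ 2)) - 1 / N * φ p| ≤
      1 / N * (C * (K * |1 - √((q - p) / e)|) + L * (q - p)) := by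
  have hd : 0 < q - p := sub_pos.mpr hpq
  have hφ : Continuous φ :=
    (LipschitzWith.of_dist_le_mul (K := ⟨L, hL⟩) fun a b => hLip a b).continuous
  have hconst : 1 / N * φ p = ∫ _t in p..q, 1 / (N * (q - p)) * φ p := by
    rw [intervalIntegral.integral_const, smul_eq_mul]
    field_simp
  have hint : IntervalIntegrable (fun t => φ t * (1 / (N * (q - p) ^ 2) *
      ((t - p) / √(q - p) + (q - t) / √e) ^ 2)) volume p q :=
    Continuous.intervalIntegrable (by fun_prop) _ _
  rw [hconst, ← intervalIntegral.integral_sub hint intervalIntegrable_const]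
  have hbound := intervalIntegral.norm_integral_le_of_norm_le_const (a := p) (b := q)
    (f := fun t => φ t * (1 / (N * (q - p) ^ 2) *
      ((t - p) / √(q - p) + (q - t) / √e) ^ 2) - 1 / (N * (q - p)) * φ p)
    (C := 1 / (N * (q - p)) * (C * (K * |1 - √((q - p) / e)|) + L * (q - p))) ?_
  · rw [Real.norm_eq_abs, abs_of_pos hd] at hbound
    refine hbound.trans_eq ?_
    field_simp
  · intro t ht
    rw [Set.uIoc_of_le hpq.le] at ht
    obtain ⟨hpt, htq⟩ := ht
    have hqt : q - t = (q - p) - (t - p) := by ring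
    rw [hqt, density_eq_convex_combination_sq hd he]
    set r := √((q - p) / e)
    set θ := (t - p) / (q - p)
    have h0 : 0 ≤ θ := div_nonneg (by linarith) hd.le
    have h1 : θ ≤ 1 := (div_le_one hd).mpr (by linarith)
    have hsplit : φ t * (1 / (N * (q - p)) * (θ + (1 - θ) * r) ^ 2) - 1 / (N * (q - p)) * φ p =
        1 / (N * (q - p)) * (φ t * ((θ + (1 - θ) * r) ^ 2 - 1) + (φ t - φ p)) := by ring
    have hpos : 0 < 1 / (N * (q - p)) := by positivity
    rw [Real.norm_eq_abs, hsplit, abs_mul, abs_of_pos hpos]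
    gcongr
    refine (abs_add_le _ _).trans (add_le_add ?_ ?_)
    · rw [abs_mul]
      exact mul_le_mul (hbd t)
        (abs_convex_combination_sq_sub_one_le h0 h1 (Real.sqrt_nonneg _) hK)
        (abs_nonneg _) ((abs_nonneg _).trans (hbd t))
    · refine (hLip t p).trans ?_
      gcongr
      rw [abs_of_pos (by linarith)]
      linarith

/-- The piecewise-quadratic interpolation
`ν_N(t) = (1/(N Δx_{i+1}²))((t - x_i)/√Δx_{i+1} + (x_{i+1} - t)/√Δx_i)²`
on `[x_i, x_{i+1}]` satisfies, for bounded `L`-Lipschitz `φ` with `|φ| ≤ C`,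
`|∫ φ ν_N - (1/N) ∑ φ(x_i)| ≤ (2a₂C/a₁)·max_{2 ≤ i ≤ N} |1 - √(Δx_i/Δx_{i-1})|
  + (La₂ + C)/N`. -/
theorem interpolation_weak_approx (N : ℕ) (hN : 2 ≤ N) (a1 a2 : ℝ)
    (ha1 : 0 < a1) (ha12 : a1 ≤ a2)
    (x : ℕ → ℝ) (hx : ∀ i, 1 ≤ i → i < N → x i < x (i + 1))
    (hlb : ∀ i, 2 ≤ i → i ≤ N → a1 / N ≤ x i - x (i - 1))
    (hub : ∀ i, 2 ≤ i → i ≤ N → x i - x (i - 1) ≤ a2 / N)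
    (φ : ℝ → ℝ) (L C : ℝ) (hL : 0 ≤ L)
    (hLip : ∀ a b, |φ a - φ b| ≤ L * |a - b|)
    (hbd : ∀ a, |φ a| ≤ C) :
    |(∑ i ∈ Finset.Icc 1 (N - 1), ∫ t in (x i)..(x (i + 1)),
        φ t * (1 / ((N : ℝ) * Dx x (i + 1) ^ 2) *
          ((t - x i) / Real.sqrt (Dx x (i + 1)) +
            (x (i + 1) - t) / Real.sqrt (Dx x i)) ^ 2))
      - (1 / N : ℝ) * ∑ i ∈ Finset.Icc 1 N, φ (x i)|
    ≤ 2 * a2 * C / a1 *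
        (Finset.Icc 2 N).sup' (Finset.nonempty_Icc.mpr (by omega))
          (fun i => |1 - Real.sqrt (Dx x i / Dx x (i - 1))|)
      + (L * a2 + C) / N := by
  have hN0 : (0 : ℝ) < N := by exact_mod_cast (by omega : 0 < N)
  have hC : 0 ≤ C := (abs_nonneg _).trans (hbd 0)
  have ha2 : 0 < a2 := ha1.trans_le ha12
  have hDx_succ : ∀ i, 1 ≤ i → Dx x (i + 1) = x (i + 1) - x i := by
    intro i hi
    simp [Dx, show i ≠ 0 by omega]
  have hDx : ∀ i, 1 ≤ i → i ≤ N → a1 / N ≤ Dx x i ∧ Dx x i ≤ a2 / N := by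
    intro i hi hiN
    unfold Dx
    split_ifs with h
    · exact ⟨hlb 2 le_rfl hN, hub 2 le_rfl hN⟩
    · exact ⟨hlb i (by omega) hiN, hub i (by omega) hiN⟩
  set M := (Finset.Icc 2 N).sup' (Finset.nonempty_Icc.mpr (by omega))
    (fun i => |1 - √(Dx x i / Dx x (i - 1))|)
  have hle_M : ∀ i, 2 ≤ i → i ≤ N → |1 - √(Dx x i / Dx x (i - 1))| ≤ M := fun i h2 hi =>
    Finset.le_sup' (fun i => |1 - √(Dx x i / Dx x (i - 1))|) (Finset.mem_Icc.mpr ⟨h2, hi⟩)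
  have hM0 : 0 ≤ M := (abs_nonneg _).trans (hle_M 2 le_rfl hN)
  have hcell : ∀ i ∈ Finset.Icc 1 (N - 1),
      |(∫ t in (x i)..(x (i + 1)), φ t * (1 / ((N : ℝ) * Dx x (i + 1) ^ 2) *
          ((t - x i) / √(Dx x (i + 1)) + (x (i + 1) - t) / √(Dx x i)) ^ 2))
        - 1 / N * φ (x i)| ≤ 1 / N * (2 * a2 * C / a1 * M + L * a2 / N) := by
    intro i hi
    obtain ⟨hi1, hiN⟩ := Finset.mem_Icc.mp hi
    obtain ⟨he1, -⟩ := hDx i hi1 (by omega)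
    obtain ⟨-, hd2⟩ := hDx (i + 1) (by omega) (by omega)
    have hr := hle_M (i + 1) (by omega) (by omega)
    rw [Nat.add_sub_cancel] at hr
    rw [hDx_succ i hi1] at hd2 hr ⊢
    have he : 0 < Dx x i := lt_of_lt_of_le (by positivity) he1
    have hone : 1 ≤ a2 / a1 := (one_le_div ha1).mpr ha12
    have hratio : (x (i + 1) - x i) / Dx x i ≤ a2 / a1 :=
      calc (x (i + 1) - x i) / Dx x i ≤ (a2 / N) / (a1 / N) := by gcongr
        _ = a2 / a1 := by field_simp
    have hsqrt : √((x (i + 1) - x i) / Dx x i) ≤ a2 / a1 :=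
      (Real.sqrt_le_sqrt hratio).trans (Real.sqrt_le_iff.mpr ⟨by positivity, by nlinarith⟩)
    refine (abs_cell_integral_sub_le (K := 2 * (a2 / a1)) hN0 (hx i hi1 (by omega)) he
      (by linarith) hL hLip hbd).trans ?_
    calc 1 / (N : ℝ) * (C * (2 * (a2 / a1) * |1 - √((x (i + 1) - x i) / Dx x i)|)
          + L * (x (i + 1) - x i))
        ≤ 1 / N * (C * (2 * (a2 / a1) * M) + L * (a2 / N)) := by gcongr
      _ = 1 / N * (2 * a2 * C / a1 * M + L * a2 / N) := by ring
  have hlast : ∑ i ∈ Finset.Icc 1 N, φ (x i) =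
      ∑ i ∈ Finset.Icc 1 (N - 1), φ (x i) + φ (x N) := by
    obtain ⟨n, rfl⟩ : ∃ n, N = n + 1 := ⟨N - 1, by omega⟩
    rw [Finset.sum_Icc_succ_top (by omega), Nat.add_sub_cancel]
  rw [hlast, mul_add, ← sub_sub, Finset.mul_sum, ← Finset.sum_sub_distrib]
  have hB : 0 ≤ 2 * a2 * C / a1 * M + L * a2 / N := by positivity
  have hcard : ((Finset.Icc 1 (N - 1)).card : ℝ) ≤ N := by
    rw [Nat.card_Icc]
    exact_mod_cast (by omega : N - 1 + 1 - 1 ≤ N)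
  refine (abs_sub _ _).trans ((add_le_add ((Finset.abs_sum_le_sum_abs _ _).trans
    (Finset.sum_le_card_nsmul _ _ _ hcell)) (d := C / N) ?_).trans ?_)
  · rw [abs_mul, abs_of_pos (by positivity), one_div, inv_mul_eq_div]
    gcongr
    exact hbd _
  · rw [nsmul_eq_mul]
    calc ((Finset.Icc 1 (N - 1)).card : ℝ) * (1 / N * (2 * a2 * C / a1 * M + L * a2 / N)) + C / N
        ≤ N * (1 / N * (2 * a2 * C / a1 * M + L * a2 / N)) + C / N := by gcongr
      _ = 2 * a2 * C / a1 * M + (L * a2 + C) / N := by field_simp; ring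
end

section
/- Let N ≥ 2 and let x_1 < x_2 < ⋯ < x_N be real numbers; set, by convention, Δx_1 = Δx_2. Define ν_N : [x_1, x_N] → (0,∞) piecewise by ν_N(x) = (1/(N Δx_{i+1}²)) ( (x − x_i)/√Δx_{i+1} + (x_{i+1} − x)/√Δx_i )² for x ∈ [x_i, x_{i+1}], i = 1,…,N−1. Then ν_N is differentiable on each open interval (x_i, x_{i+1}) and its Fisher information satisfies the exact identity Σ_{i=1}^{N−1} ∫_{x_i}^{x_{i+1}} ν_N'(x)²/ν_N(x) dx = (4/N) Σ_{i=1}^{N−1} (1/Δx_{i+1} − 1/Δx_i)² / (1 + √(Δx_{i+1}/Δx_i))². -/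
open MeasureTheory

/-- The piece of the interpolation `ν_N` on `[x_i, x_{i+1}]`:
`ν_N(t) = (1/(N Δx_{i+1}²))((t - x_i)/√Δx_{i+1} + (x_{i+1} - t)/√Δx_i)²`. -/
noncomputable def nuPiece (N : ℕ) (x : ℕ → ℝ) (i : ℕ) (t : ℝ) : ℝ :=
  1 / ((N : ℝ) * Dx x (i + 1) ^ 2) *
    ((t - x i) / Real.sqrt (Dx x (i + 1)) + (x (i + 1) - t) / Real.sqrt (Dx x i)) ^ 2

theorem Dx_succ (x : ℕ → ℝ) {i : ℕ} (hi : 1 ≤ i) : Dx x (i + 1) = x (i + 1) - x i := by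
  simp [Dx, show i ≠ 0 by omega]

theorem Dx_pos {N : ℕ} (hN : 2 ≤ N) {x : ℕ → ℝ}
    (hx : ∀ i, 1 ≤ i → i < N → x i < x (i + 1)) {i : ℕ} (hi : 1 ≤ i) (hiN : i ≤ N) :
    0 < Dx x i := by
  obtain rfl | hi' := hi.eq_or_lt
  · simpa [Dx] using hx 1 le_rfl hN
  · obtain ⟨j, rfl⟩ : ∃ j, i = j + 1 := ⟨i - 1, by omega⟩
    rw [Dx_succ x (by omega)]
    exact sub_pos.2 (hx j (by omega) (by omega))

theorem hasDerivAt_nuPiece (N : ℕ) (x : ℕ → ℝ) (i : ℕ) (t : ℝ) :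
    HasDerivAt (nuPiece N x i)
      (1 / ((N : ℝ) * Dx x (i + 1) ^ 2) *
        (2 * ((t - x i) / √(Dx x (i + 1)) + (x (i + 1) - t) / √(Dx x i)) *
          (1 / √(Dx x (i + 1)) - 1 / √(Dx x i)))) t := by
  have h := (((((hasDerivAt_id t).sub_const (x i)).div_const √(Dx x (i + 1))).add
    (((hasDerivAt_id t).const_sub (x (i + 1))).div_const √(Dx x i))).pow 2).const_mul
      (1 / ((N : ℝ) * Dx x (i + 1) ^ 2))
  refine h.congr_deriv ?_
  simp only [Pi.add_apply, id, Nat.cast_ofNat]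
  ring

/-- The Fisher information density of `nuPiece` is constant on its inter-particle interval. -/
theorem deriv_nuPiece_sq_div {N : ℕ} (hN : N ≠ 0) {x : ℕ → ℝ} {i : ℕ}
    (hD : 0 < Dx x i) (hD' : 0 < Dx x (i + 1)) (hlt : x i < x (i + 1)) {t : ℝ}
    (ht : t ∈ Set.Icc (x i) (x (i + 1))) :
    deriv (nuPiece N x i) t ^ 2 / nuPiece N x i t =
      4 / ((N : ℝ) * Dx x (i + 1) ^ 2) * (1 / √(Dx x (i + 1)) - 1 / √(Dx x i)) ^ 2 := by
  rw [(hasDerivAt_nuPiece N x i t).deriv, nuPiece]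
  have ha := Real.sqrt_pos.2 hD'
  have hb := Real.sqrt_pos.2 hD
  have hL : 0 < (t - x i) / √(Dx x (i + 1)) + (x (i + 1) - t) / √(Dx x i) := by
    obtain h | h := ht.1.eq_or_lt
    · rw [← h]
      simpa using div_pos (sub_pos.2 hlt) hb
    · exact add_pos_of_pos_of_nonneg (div_pos (sub_pos.2 h) ha)
        (div_nonneg (sub_nonneg.2 ht.2) hb.le)
  have hc : (N : ℝ) * Dx x (i + 1) ^ 2 ≠ 0 := by positivity
  generalize (t - x i) / √(Dx x (i + 1)) + (x (i + 1) - t) / √(Dx x i) = L at hL ⊢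
  generalize 1 / √(Dx x (i + 1)) - 1 / √(Dx x i) = s
  generalize (N : ℝ) * Dx x (i + 1) ^ 2 = c at hc ⊢
  field_simp
  ring

theorem sq_inv_sqrt_sub_inv_sqrt_div {p q : ℝ} (hp : 0 < p) (hq : 0 < q) :
    (1 / √p - 1 / √q) ^ 2 / p = (1 / p - 1 / q) ^ 2 / (1 + √(p / q)) ^ 2 := by
  rw [Real.sqrt_div hp.le]
  have ha := Real.sqrt_pos.2 hp
  have hb := Real.sqrt_pos.2 hq
  have hp' := Real.sq_sqrt hp.le
  have hq' := Real.sq_sqrt hq.le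
  generalize √p = a at *
  generalize √q = b at *
  subst hp' hq'
  have : b + a ≠ 0 := by positivity
  field_simp
  ring

/-- The interpolation `ν_N` is differentiable on each open
inter-particle interval and its Fisher information is exactly
`∑_{i=1}^{N-1} ∫_{x_i}^{x_{i+1}} ν_N'²/ν_N
  = (4/N) ∑_{i=1}^{N-1} (1/Δx_{i+1} - 1/Δx_i)² / (1 + √(Δx_{i+1}/Δx_i))²`. -/
theorem interpolation_fisher_information (N : ℕ) (hN : 2 ≤ N)
    (x : ℕ → ℝ) (hx : ∀ i, 1 ≤ i → i < N → x i < x (i + 1)) :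
    (∀ i ∈ Finset.Icc 1 (N - 1), ∀ t ∈ Set.Ioo (x i) (x (i + 1)),
      DifferentiableAt ℝ (nuPiece N x i) t) ∧
    ∑ i ∈ Finset.Icc 1 (N - 1), ∫ t in (x i)..(x (i + 1)),
        (deriv (nuPiece N x i) t) ^ 2 / nuPiece N x i t
      = (4 / N : ℝ) * ∑ i ∈ Finset.Icc 1 (N - 1),
          (1 / Dx x (i + 1) - 1 / Dx x i) ^ 2 /
            (1 + Real.sqrt (Dx x (i + 1) / Dx x i)) ^ 2 := by
  have hpos : ∀ i ∈ Finset.Icc 1 (N - 1), 1 ≤ i ∧ i < N := fun i hi => by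
    rw [Finset.mem_Icc] at hi
    omega
  refine ⟨fun i _ t _ => (hasDerivAt_nuPiece N x i t).differentiableAt, ?_⟩
  rw [Finset.mul_sum]
  refine Finset.sum_congr rfl fun i hi => ?_
  obtain ⟨hi1, hiN⟩ := hpos i hi
  have hlt := hx i hi1 hiN
  have hD : 0 < Dx x i := Dx_pos hN hx hi1 hiN.le
  have hD' : 0 < Dx x (i + 1) := Dx_pos hN hx (by omega) hiN
  rw [intervalIntegral.integral_congr fun t ht =>
      deriv_nuPiece_sq_div (by omega) hD hD' hlt (Set.uIcc_of_le hlt.le ▸ ht),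
    intervalIntegral.integral_const, ← Dx_succ x hi1, ← sq_inv_sqrt_sub_inv_sqrt_div hD' hD,
    smul_eq_mul]
  have hN0 : (N : ℝ) ≠ 0 := by positivity
  generalize 1 / √(Dx x (i + 1)) - 1 / √(Dx x i) = s
  field_simp
end
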